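/- arXiv:1106.0741 — 5 statements merged into one kernel-verified Lean document; each statement's English description precedes it below -/
import Mathlib

section
/- With notation as in the context, the diagonal ideal 𝔻 is of linear type: the canonical surjection from the symmetric algebra Sym_S(𝔻) onto the Rees algebra R(𝔻) is an isomorphism. -/
open MvPolynomial Finset

/-- The index of the entry in row `i`, column `j` (1-based) of an `m × n` matrix of variables. -/
def ent (m n : ℕ) (hm : 0 < m) (hn : 0 < n) (i j : ℕ) : Fin m × Fin n :=
  (⟨(i - 1) % m, Nat.mod_lt _ hm⟩, ⟨(j - 1) % n, Nat.mod_lt _ hn⟩)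

/-- The ideal generated by the maximal minors of the submatrix on the first `s` rows and first
`t` columns of a matrix of variables, where `v i j` denotes the variable sitting in row `i` and
column `j` (1-based). -/
noncomputable def maxMinors {σ : Type*} (k : Type*) [Field k] (s t : ℕ)
    (v : ℕ → ℕ → σ) : Ideal (MvPolynomial σ k) :=
  Ideal.span {d | ∃ c : ℕ → ℕ, StrictMonoOn c (Set.Icc 1 s) ∧ 1 ≤ c 1 ∧ c s ≤ t ∧
    d = (Matrix.of fun i j : Fin s =>
          (X (v ((i : ℕ) + 1) (c ((j : ℕ) + 1))) : MvPolynomial σ k)).det}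

/-- Variables of the polynomial ring `k[X,Y]`: two `m × n` matrices of indeterminates. -/
abbrev Vxy (m n : ℕ) := (Fin m × Fin n) ⊕ (Fin m × Fin n)

/-- The ring `S = k[X,Y]/(I_{s₁}(X_{s₁t₁}) + I_{s₂}(Y_{s₂t₂}))`. -/
abbrev detQuot (k : Type*) [Field k] (m n s₁ s₂ t₁ t₂ : ℕ) (hm : 0 < m) (hn : 0 < n) :=
  MvPolynomial (Vxy m n) k ⧸
    (maxMinors k s₁ t₁ (fun i j => (Sum.inl (ent m n hm hn i j) : Vxy m n)) ⊔
     maxMinors k s₂ t₂ (fun i j => (Sum.inr (ent m n hm hn i j) : Vxy m n)))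

/-- The diagonal ideal `𝔻 ⊆ S`, generated by the images of the elements `x_{ij} - y_{ij}`. -/
noncomputable def diagIdeal (k : Type*) [Field k] (m n s₁ s₂ t₁ t₂ : ℕ)
    (hm : 0 < m) (hn : 0 < n) : Ideal (detQuot k m n s₁ s₂ t₁ t₂ hm hn) :=
  Ideal.span {d | ∃ i j : ℕ, 1 ≤ i ∧ i ≤ m ∧ 1 ≤ j ∧ j ≤ n ∧
    d = Ideal.Quotient.mk _
      (X (Sum.inl (ent m n hm hn i j)) - X (Sum.inr (ent m n hm hn i j)))}

/-- The symmetric algebra `Sym_S(M)` of an `S`-module `M`, constructed as the quotient of the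
tensor algebra by the commutativity relations `x ⊗ y = y ⊗ x` for `x, y ∈ M`. -/
abbrev SymmetricAlg (S M : Type*) [CommRing S] [AddCommGroup M] [Module S M] :=
  RingQuot (fun a b : TensorAlgebra S M =>
    ∃ x y : M, a = TensorAlgebra.ι S x * TensorAlgebra.ι S y ∧
      b = TensorAlgebra.ι S y * TensorAlgebra.ι S x)

/-- The `S`-linear map `𝔻 → R(𝔻)` sending `d` to `d·t`. -/
noncomputable def toRees {S : Type*} [CommRing S] (D : Ideal S) :
    D →ₗ[S] reesAlgebra D where
  toFun d := ⟨Polynomial.monomial 1 (d : S), reesAlgebra.monomial_mem.mpr (by simpa using d.2)⟩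
  map_add' a b := Subtype.ext (by simp)
  map_smul' c a := Subtype.ext (by simp [Polynomial.smul_monomial, smul_eq_mul])

/-- The canonical surjection `Sym_S(𝔻) → R(𝔻)`, the `S`-algebra map induced by
`𝔻 → 𝔻t ⊆ R(𝔻)`. -/
noncomputable def symToRees {S : Type*} [CommRing S] (D : Ideal S) :
    SymmetricAlg S D →ₐ[S] reesAlgebra D :=
  RingQuot.liftAlgHom S ⟨TensorAlgebra.lift S (toRees D), by
    rintro a b ⟨x, y, rfl, rfl⟩
    simp [mul_comm]⟩

section Leading

variable {V k : Type*} [Field k] [DecidableEq V]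

/-- A polynomial viewed as a univariate polynomial in the variable `v`. -/
noncomputable def collect (v : V) : MvPolynomial V k →ₐ[k] Polynomial (MvPolynomial V k) :=
  aeval fun w => if w = v then Polynomial.X else Polynomial.C (X w)

/-- Substitution of `0` for the variable `v`. -/
noncomputable def kill (v : V) : MvPolynomial V k →ₐ[k] MvPolynomial V k :=
  aeval fun w => if w = v then 0 else X w

lemma kill_X_of_ne {v w : V} (h : w ≠ v) : kill v (X w : MvPolynomial V k) = X w := by
  simp [kill, h]

lemma collect_X_self (v : V) : collect v (X v : MvPolynomial V k) = Polynomial.X := by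
  simp [collect]

lemma collect_kill (v : V) (p : MvPolynomial V k) :
    collect v (kill v p) = Polynomial.C (kill v p) := by
  have : (collect v).comp (kill v) = (Polynomial.CAlgHom (R := k)).comp (kill (k := k) v) := by
    ext w
    by_cases h : w = v <;> simp [collect, kill, h]
  exact DFunLike.congr_fun this p

lemma collect_eq_C {v : V} {p : MvPolynomial V k} (h : kill v p = p) :
    collect v p = Polynomial.C p := by
  rw [← h, collect_kill]

lemma map_kill_collect (v : V) (p : MvPolynomial V k) :
    (collect v p).map (kill v : MvPolynomial V k →ₐ[k] MvPolynomial V k).toRingHom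
      = collect v p := by
  have : (Polynomial.mapAlgHom (kill v)).comp (collect v) = collect (k := k) v := by
    ext w
    by_cases h : w = v <;> simp [collect, kill, h]
  exact DFunLike.congr_fun this p

lemma kill_coeff_collect (v : V) (p : MvPolynomial V k) (i : ℕ) :
    kill v ((collect v p).coeff i) = (collect v p).coeff i := by
  conv_rhs => rw [← map_kill_collect v p, Polynomial.coeff_map]
  rfl

lemma aeval_update {A : Type*} [CommRing A] [Algebra k A] (v : V) (x : V → A) (y : A)
    (p : MvPolynomial V k) :
    aeval (Function.update x v y) p
      = (collect v p).eval₂ (aeval x : MvPolynomial V k →ₐ[k] A).toRingHom y := by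
  induction p using MvPolynomial.induction_on with
  | C a => simp [collect]
  | add p q hp hq => rw [map_add, map_add, Polynomial.eval₂_add, hp, hq]
  | mul_X p w hp =>
    rw [map_mul, map_mul, Polynomial.eval₂_mul, hp]
    by_cases h : w = v <;> simp [collect, h]

lemma eval_collect (v : V) (p : MvPolynomial V k) : (collect v p).eval (X v) = p := by
  have h := aeval_update (A := MvPolynomial V k) v X (X v) p
  rw [Function.update_eq_self, aeval_X_left_apply] at h
  conv_rhs => rw [h]
  rw [aeval_X_left]
  rfl

/-- An ideal contains all `p` satisfying `K` as soon as the leading coefficients of such `p` with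
respect to `v` are accounted for by elements `v * g + h` of the ideal with `g`, `h` free of `v`. -/
lemma mem_of_leadingCoeff_mem (v : V) (K : MvPolynomial V k → Prop) (Q : Ideal (MvPolynomial V k))
    (G : Set (MvPolynomial V k)) (hK : ∀ p, K p → ∀ q ∈ Q, K (p - q))
    (hG : ∀ g ∈ G, kill v g = g ∧ ∃ h, kill v h = h ∧ X v * g + h ∈ Q)
    (hlead : ∀ p, K p → (collect v p).leadingCoeff ∈ Ideal.span G)
    (hfree : ∀ p, K p → kill v p = p → p ∈ Q) (p : MvPolynomial V k) (hp : K p) : p ∈ Q := by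
  have lift : ∀ c ∈ Ideal.span G, ∃ h, kill v h = h ∧ X v * kill v c + h ∈ Q := by
    intro c hc
    induction hc using Submodule.span_induction with
    | mem g hg =>
      obtain ⟨h1, h, h2, h3⟩ := hG g hg
      exact ⟨h, h2, by rwa [h1]⟩
    | zero => exact ⟨0, by simp, by simp⟩
    | add a b _ _ ha hb =>
      obtain ⟨h1, h2, h3⟩ := ha
      obtain ⟨h4, h5, h6⟩ := hb
      refine ⟨h1 + h4, by simp [h2, h5], ?_⟩
      convert Q.add_mem h3 h6 using 1
      rw [map_add]; ring
    | smul a c _ hc =>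
      obtain ⟨h, h2, h3⟩ := hc
      refine ⟨kill v a * h, ?_, ?_⟩
      · have := kill_coeff_collect v (kill v a) 0
        rw [collect_kill, Polynomial.coeff_C_zero] at this
        rw [map_mul, this, h2]
      · convert Q.mul_mem_left (kill v a) h3 using 1
        rw [smul_eq_mul, map_mul]; ring
  induction hd : (collect v p).natDegree using Nat.strong_induction_on generalizing p with
  | _ d ih =>
  subst hd
  set d := (collect v p).natDegree with hd
  rcases Nat.eq_zero_or_pos d with h0 | h0
  · refine hfree p hp ?_
    have h1 := Polynomial.eq_C_of_natDegree_eq_zero h0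
    have h2 := eval_collect v p
    rw [h1, Polynomial.eval_C] at h2
    rw [← h2, kill_coeff_collect]
  · have hc : kill v (collect v p).leadingCoeff = (collect v p).leadingCoeff :=
      kill_coeff_collect v p d
    obtain ⟨h, h1, h2⟩ := lift _ (hlead p hp)
    rw [hc] at h2
    set c := (collect v p).leadingCoeff with hcdef
    have hq : X v ^ (d - 1) * (X v * c + h) ∈ Q := Q.mul_mem_left _ h2
    have hlt : (collect v (p - X v ^ (d - 1) * (X v * c + h))).natDegree < d := by
      have e : collect v (p - X v ^ (d - 1) * (X v * c + h))
          = (collect v p).eraseLead - Polynomial.C h * Polynomial.X ^ (d - 1) := by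
        have hlead := Polynomial.self_sub_C_mul_X_pow (collect v p)
        rw [← hd, ← hcdef] at hlead
        rw [← hlead, map_sub, map_mul, map_pow, map_add, map_mul, collect_X_self,
          collect_eq_C hc, collect_eq_C h1]
        have hpow : (Polynomial.X : Polynomial (MvPolynomial V k)) ^ d
            = Polynomial.X ^ (d - 1) * Polynomial.X := by rw [← pow_succ, Nat.sub_add_cancel h0]
        rw [hpow]; ring
      rw [e]
      have := Polynomial.natDegree_sub_le_of_le (Polynomial.eraseLead_natDegree_le (collect v p))
        (Polynomial.natDegree_C_mul_X_pow_le h (d - 1))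
      rw [← hd, max_self] at this
      omega
    have := ih _ hlt _ (hK p hp _ hq) rfl
    simpa using Q.add_mem this hq

end Leading

section Perturbation

variable {V k L : Type*} [Field k] [Field L] [Algebra k L]

/-- The value of a multivariate polynomial along the line `x + T N`. -/
noncomputable def alongLine (x N : V → L) : MvPolynomial V k →ₐ[k] Polynomial L :=
  aeval fun w => Polynomial.C (x w) + Polynomial.C (N w) * Polynomial.X

lemma eval_alongLine (x N : V → L) (T : L) (p : MvPolynomial V k) :
    (alongLine x N p).eval T = aeval (x + T • N) p := by
  induction p using MvPolynomial.induction_on with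
  | C a => simp [alongLine]
  | add p q hp hq => simp [hp, hq]
  | mul_X p w hp =>
    rw [map_mul, map_mul, Polynomial.eval_mul, hp]
    simp [alongLine, mul_comm T]

variable [Infinite L]

lemma eval_zero_of_forall_ne {q : Polynomial L} (h : ∀ T : L, T ≠ 0 → q.eval T = 0) :
    q.eval 0 = 0 := by
  have : Polynomial.X * q = 0 := Polynomial.funext fun T => by
    by_cases hT : T = 0 <;> simp [hT, h]
  rcases mul_eq_zero.mp this with h | h
  · exact absurd h Polynomial.X_ne_zero
  · simp [h]

lemma aeval_eq_zero_of_line (x N : V → L) (p : MvPolynomial V k)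
    (h : ∀ T : L, T ≠ 0 → aeval (x + T • N) p = 0) : aeval x p = 0 := by
  have := eval_zero_of_forall_ne (q := alongLine x N p) fun T hT => by
    rw [eval_alongLine, h T hT]
  simpa [eval_alongLine] using this

lemma aeval_leadingCoeff_eq_zero [DecidableEq V] (v : V) (x N : V → L) (α β : L) (hα : α ≠ 0)
    (p : MvPolynomial V k)
    (h : ∀ T : L, T ≠ 0 → aeval (Function.update (x + T • N) v ((α + β * T) / T)) p = 0) :
    aeval x (collect v p).leadingCoeff = 0 := by
  set d := (collect v p).natDegree with hd
  let q : Polynomial L := ∑ i ∈ Finset.range (d + 1), alongLine x N ((collect v p).coeff i) *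
    (Polynomial.C α + Polynomial.C β * Polynomial.X) ^ i * Polynomial.X ^ (d - i)
  have hq : ∀ T : L, T ≠ 0 → q.eval T = 0 := by
    intro T hT
    have h1 := h T hT
    rw [aeval_update, Polynomial.eval₂_eq_sum_range] at h1
    have h2 : q.eval T = T ^ d * 0 := by
      rw [← h1, Polynomial.eval_finsetSum, Finset.mul_sum]
      refine Finset.sum_congr rfl fun i hi => ?_
      have hi : i ≤ d := Nat.lt_succ_iff.mp (Finset.mem_range.mp hi)
      simp only [Polynomial.eval_mul, Polynomial.eval_pow, Polynomial.eval_add, Polynomial.eval_C,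
        Polynomial.eval_X, eval_alongLine, div_pow]
      have : T ^ d = T ^ (d - i) * T ^ i := by rw [← pow_add, Nat.sub_add_cancel hi]
      rw [this]
      field_simp
      exact mul_comm _ _
    simpa using h2
  have h0 := eval_zero_of_forall_ne hq
  rw [Polynomial.eval_finsetSum, Finset.sum_eq_single_of_mem d (by simp)] at h0
  · rw [← Polynomial.coeff_natDegree, ← hd]
    simpa [eval_alongLine, hα] using h0
  · intro i hi hid
    have hi := Finset.mem_range.mp hi
    simp [show d - i ≠ 0 by omega]

/-- Membership in `Q` follows from vanishing on `S` once vanishing on two smaller families of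
points, one controlling the leading coefficients in `v` and one the polynomials free of `v`,
implies membership in suitable ideals. -/
lemma mem_of_vanishing [DecidableEq V] (v : V) {S S₁ S₀ : Set (V → L)}
    {Q : Ideal (MvPolynomial V k)} {G : Set (MvPolynomial V k)}
    (hQ : ∀ q ∈ Q, ∀ x ∈ S, aeval x q = 0)
    (hG : ∀ g ∈ G, kill v g = g ∧ ∃ h, kill v h = h ∧ X v * g + h ∈ Q)
    (h₁ : ∀ p : MvPolynomial V k, (∀ x ∈ S₁, aeval x p = 0) → p ∈ Ideal.span G)
    (h₀ : ∀ p : MvPolynomial V k, (∀ x ∈ S₀, aeval x p = 0) → p ∈ Q)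
    (hS₁ : ∀ x ∈ S₁, ∃ (N : V → L) (α β : L), α ≠ 0 ∧
      ∀ T : L, T ≠ 0 → Function.update (x + T • N) v ((α + β * T) / T) ∈ S)
    (hS₀ : ∀ x ∈ S₀, ∃ N : V → L, ∀ T : L, T ≠ 0 → ∃ y,
      Function.update (x + T • N) v y ∈ S)
    (p : MvPolynomial V k) (hp : ∀ x ∈ S, aeval x p = 0) : p ∈ Q := by
  refine mem_of_leadingCoeff_mem v (fun p => ∀ x ∈ S, aeval x p = 0) Q G ?_ hG ?_ ?_ p hp
  · intro p hp q hq x hx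
    rw [map_sub, hp x hx, hQ q hq x hx, sub_zero]
  · refine fun p hp => h₁ _ fun x hx => ?_
    obtain ⟨N, α, β, hα, h⟩ := hS₁ x hx
    exact aeval_leadingCoeff_eq_zero v x N α β hα p fun T hT => hp _ (h T hT)
  · refine fun p hp hfree => h₀ _ fun x hx => ?_
    obtain ⟨N, h⟩ := hS₀ x hx
    refine aeval_eq_zero_of_line x N p fun T hT => ?_
    obtain ⟨y, hy⟩ := h T hT
    have := hp _ hy
    rw [aeval_update, collect_eq_C hfree, Polynomial.eval₂_C] at this
    exact this

end Perturbation

section Degenerate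

variable {m n : ℕ} {L : Type*} [Field L]

/-- The rows of `M` indexed by `R`, truncated to the first `t` columns, are linearly dependent. -/
def Degenerate (M : Matrix (Fin m) (Fin n) L) (R : Finset (Fin m)) (t : ℕ) : Prop :=
  ∃ lam : Fin m → L, (∀ i ∉ R, lam i = 0) ∧ lam ≠ 0 ∧
    ∀ j : Fin n, (j : ℕ) < t → ∑ i, lam i * M i j = 0

/-- Minors of size `#R` of the rows of `M` indexed by `R` and the first `t` columns. -/
def minors {A : Type*} [CommRing A] (M : Matrix (Fin m) (Fin n) A) (R : Finset (Fin m)) (t : ℕ) :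
    Set A :=
  {d | ∃ (s : ℕ) (a : Fin s → Fin m) (c : Fin s → Fin n), s = R.card ∧ (∀ i, a i ∈ R) ∧
    (∀ j, (c j : ℕ) < t) ∧ d = (M.submatrix a c).det}

lemma Degenerate.congr {M M' : Matrix (Fin m) (Fin n) L} {R : Finset (Fin m)} {t : ℕ}
    (h : Degenerate M R t) (hM : ∀ i ∈ R, ∀ j : Fin n, (j : ℕ) < t → M' i j = M i j) :
    Degenerate M' R t := by
  obtain ⟨lam, h0, hne, hsum⟩ := h
  refine ⟨lam, h0, hne, fun j hj => ?_⟩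
  rw [← hsum j hj]
  refine Finset.sum_congr rfl fun i _ => ?_
  by_cases hi : i ∈ R
  · rw [hM i hi j hj]
  · rw [h0 i hi, zero_mul, zero_mul]

lemma Degenerate.mono {M : Matrix (Fin m) (Fin n) L} {R R' : Finset (Fin m)} {t t' : ℕ}
    (h : Degenerate M R t) (hR : R ⊆ R') (ht : t' ≤ t) : Degenerate M R' t' := by
  obtain ⟨lam, h0, hne, hsum⟩ := h
  exact ⟨lam, fun i hi => h0 i fun h => hi (hR h), hne, fun j hj => hsum j (hj.trans_le ht)⟩

lemma degenerate_zero (M : Matrix (Fin m) (Fin n) L) {R : Finset (Fin m)} (hR : R.Nonempty) :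
    Degenerate M R 0 := by
  obtain ⟨r, hr⟩ := hR
  refine ⟨Pi.single r 1, fun i hi => ?_, by simp, fun j hj => absurd hj (Nat.not_lt_zero _)⟩
  exact Pi.single_eq_of_ne (fun h : i = r => hi (h ▸ hr)) _

lemma Degenerate.minor_eq_zero {M : Matrix (Fin m) (Fin n) L} {R : Finset (Fin m)} {t : ℕ}
    (h : Degenerate M R t) {d : L} (hd : d ∈ minors M R t) : d = 0 := by
  obtain ⟨lam, h0, hne, hsum⟩ := h
  obtain ⟨s, a, c, hs, ha, hc, rfl⟩ := hd
  by_cases hinj : Function.Injective a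
  · have himg : Finset.univ.image a = R := by
      refine Finset.eq_of_subset_of_card_le (fun i hi => ?_) ?_
      · obtain ⟨j, _, rfl⟩ := Finset.mem_image.mp hi
        exact ha j
      · rw [Finset.card_image_of_injective _ hinj, Finset.card_univ, Fintype.card_fin, hs]
    refine Matrix.exists_vecMul_eq_zero_iff.mp ⟨lam ∘ a, fun h => hne ?_, ?_⟩
    · funext i
      by_cases hi : i ∈ R
      · rw [← himg] at hi
        obtain ⟨j, _, rfl⟩ := Finset.mem_image.mp hi
        exact congr_fun h j
      · exact h0 i hi
    · funext j
      simp only [Matrix.vecMul, dotProduct, Function.comp_apply, Matrix.submatrix_apply,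
        Pi.zero_apply]
      rw [← hsum (c j) (hc j)]
      rw [← Finset.sum_subset (Finset.subset_univ R) fun i _ hi => by rw [h0 i hi, zero_mul],
        ← himg, Finset.sum_image hinj.injOn]
  · simp only [Function.Injective, not_forall] at hinj
    obtain ⟨i, j, hij, hne⟩ := hinj
    exact Matrix.det_zero_of_row_eq hne (funext fun l => by simp [hij])

/-- A degenerate matrix is the limit of degenerate matrices with one more row and column whose
corner entry tends to infinity. -/
lemma Degenerate.exists_corner {M : Matrix (Fin m) (Fin n) L} {R : Finset (Fin m)} {r : Fin m}
    {l : Fin n} (hr : r ∈ R) (h : Degenerate M (R.erase r) l) :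
    ∃ N : Matrix (Fin m) (Fin n) L, ∀ T : L, T ≠ 0 → ∀ M' : Matrix (Fin m) (Fin n) L,
      (∀ i j, (i, j) ≠ (r, l) → M' i j = M i j + T * N i j) → M' r l = T⁻¹ →
      Degenerate M' R (l + 1) := by
  obtain ⟨lam, h0, hne, hsum⟩ := h
  have hr0 : lam r = 0 := h0 r (by simp)
  refine ⟨fun i j => if i = r ∨ j = l then 0 else M i l * M r j, fun T hT M' hM' hrl => ?_⟩
  refine ⟨lam - Pi.single r (T * ∑ i, lam i * M i l), fun i hi => ?_, fun h => hne ?_,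
    fun j hj => ?_⟩
  · have : i ≠ r := fun h => hi (h ▸ hr)
    simp [this, h0 i (fun h => hi (Finset.mem_of_mem_erase h))]
  · funext i
    by_cases hi : i = r
    · rw [hi, hr0]; rfl
    · simpa [hi] using congr_fun h i
  · simp only [Pi.sub_apply, sub_mul, Finset.sum_sub_distrib, Pi.single_apply, ite_mul, zero_mul,
      Finset.sum_ite_eq', Finset.mem_univ, if_true]
    by_cases hjl : j = l
    · subst hjl
      rw [hrl]
      have : ∑ i, lam i * M' i j = ∑ i, lam i * M i j := by
        refine Finset.sum_congr rfl fun i _ => ?_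
        by_cases hi : i = r
        · rw [hi, hr0, zero_mul, zero_mul]
        · rw [hM' i j (by simp [hi])]; simp
      rw [this]
      field_simp
      ring
    · have hj' : (j : ℕ) < l :=
        lt_of_le_of_ne (Nat.lt_succ_iff.mp hj) fun h => hjl (Fin.ext h)
      have : ∑ i, lam i * M' i j = ∑ i, (lam i * M i j + T * M r j * (lam i * M i l)) := by
        refine Finset.sum_congr rfl fun i _ => ?_
        by_cases hi : i = r
        · rw [hi, hr0]; ring
        · rw [hM' i j (by simp [hjl])]; simp [hi, hjl]; ring
      rw [this, Finset.sum_add_distrib, hsum j hj', ← Finset.mul_sum,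
        hM' r j (by simp [hjl])]
      simp
      ring

/-- A degenerate matrix is a limit of matrices which become degenerate with one more column after
a change of one entry of that column. -/
lemma Degenerate.exists_entry {M : Matrix (Fin m) (Fin n) L} {R : Finset (Fin m)} {r : Fin m}
    {l : Fin n} (hr : r ∈ R) (h : Degenerate M R l) :
    ∃ N : Matrix (Fin m) (Fin n) L, ∀ T : L, T ≠ 0 → ∃ y : L,
      ∀ M' : Matrix (Fin m) (Fin n) L,
      (∀ i j, (i, j) ≠ (r, l) → M' i j = M i j + T * N i j) → M' r l = y →
      Degenerate M' R (l + 1) := by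
  obtain ⟨lam, h0, hne, hsum⟩ := h
  have key : ∀ (T : L) (N : Matrix (Fin m) (Fin n) L) (mu : Fin m → L), (∀ i ∉ R, mu i = 0) →
      mu r ≠ 0 → (∀ j : Fin n, (j : ℕ) < l → ∑ i, mu i * (M i j + T * N i j) = 0) →
      ∃ y : L, ∀ M' : Matrix (Fin m) (Fin n) L,
      (∀ i j, (i, j) ≠ (r, l) → M' i j = M i j + T * N i j) → M' r l = y →
      Degenerate M' R (l + 1) := by
    intro T N mu hmu0 hmur hmu
    refine ⟨-(∑ i ∈ Finset.univ.erase r, mu i * (M i l + T * N i l)) / mu r, fun M' hM' hy =>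
      ⟨mu, hmu0, fun h => hmur (by rw [h]; rfl), fun j hj => ?_⟩⟩
    by_cases hjl : j = l
    · subst hjl
      rw [← Finset.add_sum_erase _ _ (Finset.mem_univ r), hy, mul_div_cancel₀ _ hmur,
        neg_add_eq_zero]
      refine Finset.sum_congr rfl fun i hi => ?_
      rw [hM' i j (by simp [Finset.ne_of_mem_erase hi])]
    · rw [← hmu j (lt_of_le_of_ne (Nat.lt_succ_iff.mp hj) fun h => hjl (Fin.ext h))]
      exact Finset.sum_congr rfl fun i hi => by rw [hM' i j (by simp [hjl])]
  by_cases hlr : lam r = 0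
  · obtain ⟨i₀, hi₀⟩ := Function.ne_iff.mp hne
    rw [Pi.zero_apply] at hi₀
    have hir : i₀ ≠ r := fun h => hi₀ (h ▸ hlr)
    refine ⟨fun i j => if i = i₀ then -M r j / lam i₀ else 0, fun T hT =>
      key T _ (lam + Pi.single r T) (fun i hi => ?_) (by simpa [hlr] using hT) fun j hj => ?_⟩
    · have : i ≠ r := fun h => hi (h ▸ hr)
      simp [this, h0 i hi]
    · have : ∀ i, (lam + Pi.single r T : Fin m → L) i *
          (M i j + T * if i = i₀ then -M r j / lam i₀ else 0)
            = lam i * M i j + (if i = i₀ then -(T * M r j) else 0)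
              + if i = r then T * M r j else 0 := by
        intro i
        by_cases h1 : i = r
        · subst h1
          simp [Ne.symm hir, hlr]
        · by_cases h2 : i = i₀
          · subst h2
            simp [h1]
            field_simp
          · simp [h1, h2]
      simp only [this, Finset.sum_add_distrib, hsum j hj]
      simp
  · exact ⟨0, fun T _ => key T 0 lam h0 hlr fun j hj => by simpa using hsum j hj⟩

end Degenerate

section Relations

variable {m n : ℕ} {k : Type*} [Field k]

/-- The variables `σ`, `x_{ij}` and `z_{ij}`. -/
abbrev Vxz (m n : ℕ) := Option ((Fin m × Fin n) ⊕ (Fin m × Fin n))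

section Matrices

variable (m n : ℕ) (k : Type*) [Field k]

/-- The parameter `σ`. -/
noncomputable def sg : MvPolynomial (Vxz m n) k := X none

/-- The generic matrix `X`. -/
noncomputable def xm : Matrix (Fin m) (Fin n) (MvPolynomial (Vxz m n) k) :=
  fun i j => X (some (Sum.inl (i, j)))

/-- The generic matrix `Z`. -/
noncomputable def zm : Matrix (Fin m) (Fin n) (MvPolynomial (Vxz m n) k) :=
  fun i j => X (some (Sum.inr (i, j)))

/-- The matrix `Y = X + σ Z`. -/
noncomputable def ym : Matrix (Fin m) (Fin n) (MvPolynomial (Vxz m n) k) :=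
  fun i j => xm m n k i j + sg m n k * zm m n k i j

/-- The difference quotients `(f(Y) - f(X)) / σ` for the minors `f` of size `#R` of the rows
indexed by `R` and the first `t` columns. -/
noncomputable def diffs (R : Finset (Fin m)) (t : ℕ) : Set (MvPolynomial (Vxz m n) k) :=
  {F | ∃ (s : ℕ) (a : Fin s → Fin m) (c : Fin s → Fin n), s = R.card ∧ (∀ i, a i ∈ R) ∧
    (∀ j, (c j : ℕ) < t) ∧
    sg m n k * F = ((ym m n k).submatrix a c).det - ((xm m n k).submatrix a c).det}

/-- The generators of `relIdeal`. -/
noncomputable def relGens (R₁ : Finset (Fin m)) (t₁ : ℕ) (R₂ : Finset (Fin m)) (t₂ : ℕ) :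
    Set (MvPolynomial (Vxz m n) k) :=
  minors (xm m n k) R₁ t₁ ∪ minors (ym m n k) R₂ t₂ ∪
    {F | (R₁ ∩ R₂).Nonempty ∧ F ∈ diffs m n k (R₁ ∪ R₂) (min t₁ t₂)}

/-- The candidate for the ideal of all polynomials vanishing on `degPoints`. -/
noncomputable def relIdeal (R₁ : Finset (Fin m)) (t₁ : ℕ) (R₂ : Finset (Fin m)) (t₂ : ℕ) :
    Ideal (MvPolynomial (Vxz m n) k) :=
  Ideal.span (relGens m n k R₁ t₁ R₂ t₂)

end Matrices

lemma minors_mono {A : Type*} [CommRing A] (M : Matrix (Fin m) (Fin n) A) (R : Finset (Fin m))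
    {t t' : ℕ} (h : t ≤ t') : minors M R t ⊆ minors M R t' := by
  rintro d ⟨s, a, c, hs, ha, hc, rfl⟩
  exact ⟨s, a, c, hs, ha, fun j => (hc j).trans_le h, rfl⟩

lemma diffs_mono (R : Finset (Fin m)) {t t' : ℕ} (h : t ≤ t') :
    diffs m n k R t ⊆ diffs m n k R t' := by
  rintro d ⟨s, a, c, hs, ha, hc, hd⟩
  exact ⟨s, a, c, hs, ha, fun j => (hc j).trans_le h, hd⟩

lemma relIdeal_mono {R₁ R₂ : Finset (Fin m)} {t₁ t₂ t₁' t₂' : ℕ} (h₁ : t₁ ≤ t₁')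
    (h₂ : t₂ ≤ t₂') : relIdeal m n k R₁ t₁ R₂ t₂ ≤ relIdeal m n k R₁ t₁' R₂ t₂' :=
  Ideal.span_mono <| Set.union_subset_union
    (Set.union_subset_union (minors_mono _ _ h₁) (minors_mono _ _ h₂))
    fun _ hF => ⟨hF.1, diffs_mono _ (min_le_min h₁ h₂) hF.2⟩

lemma one_mem_minors_empty {A : Type*} [CommRing A] (M : Matrix (Fin m) (Fin n) A) (t : ℕ) :
    (1 : A) ∈ minors M ∅ t :=
  ⟨0, Fin.elim0, Fin.elim0, by simp, fun i => i.elim0, fun i => i.elim0, by simp⟩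

lemma sg_ne_zero : sg m n k ≠ 0 := X_ne_zero _

lemma sg_dvd_minor_sub {s : ℕ} (a : Fin s → Fin m) (c : Fin s → Fin n) :
    sg m n k ∣ ((ym m n k).submatrix a c).det - ((xm m n k).submatrix a c).det := by
  rw [← Ideal.mem_span_singleton, ← Ideal.Quotient.mk_eq_mk_iff_sub_mem, RingHom.map_det,
    RingHom.map_det]
  congr 1
  ext i j
  simp only [RingHom.mapMatrix_apply, Matrix.map_apply, Matrix.submatrix_apply, ym, map_add]
  rw [Ideal.Quotient.eq_zero_iff_mem.mpr
    (Ideal.mul_mem_right _ _ (Ideal.mem_span_singleton_self _)), add_zero]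

/-- The terms of the Laplace expansion of a bordered minor which do not involve the corner. -/
def bordRest {A : Type*} [CommRing A] (M : Matrix (Fin m) (Fin n) A) (r : Fin m) (l : Fin n)
    {s : ℕ} (a : Fin s → Fin m) (c : Fin s → Fin n) : A :=
  ∑ j : Fin s, (-1) ^ ((j : ℕ) + 1) * M r (c j) *
    (M.submatrix a ((Fin.cons l c : Fin (s + 1) → Fin n) ∘ j.succ.succAbove)).det

lemma det_bord {A : Type*} [CommRing A] (M : Matrix (Fin m) (Fin n) A) (r : Fin m) (l : Fin n)
    {s : ℕ} (a : Fin s → Fin m) (c : Fin s → Fin n) :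
    (M.submatrix (Fin.cons r a : Fin (s + 1) → Fin m) (Fin.cons l c : Fin (s + 1) → Fin n)).det
      = M r l * (M.submatrix a c).det + bordRest M r l a c := by
  rw [Matrix.det_succ_row_zero, Fin.sum_univ_succ]
  congr 1
  simp [Matrix.submatrix_submatrix, Function.comp_def]

lemma map_bordRest {A B : Type*} [CommRing A] [CommRing B] (φ : A →+* B)
    (M : Matrix (Fin m) (Fin n) A) (M' : Matrix (Fin m) (Fin n) B) (r : Fin m) (l : Fin n)
    {s : ℕ} (a : Fin s → Fin m) (c : Fin s → Fin n) (ha : ∀ i, a i ≠ r) (hc : ∀ j, c j ≠ l)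
    (hM : ∀ i j, (i, j) ≠ (r, l) → φ (M i j) = M' i j) :
    φ (bordRest M r l a c) = bordRest M' r l a c := by
  simp only [bordRest, map_sum, map_mul, map_pow, map_neg, map_one, RingHom.map_det]
  refine Finset.sum_congr rfl fun j _ => ?_
  rw [hM r (c j) (by simp [hc])]
  congr 2
  ext i i'
  simp only [RingHom.mapMatrix_apply, Matrix.map_apply, Matrix.submatrix_apply]
  exact hM _ _ (by simp [ha])

lemma map_minor {A B : Type*} [CommRing A] [CommRing B] (φ : A →+* B)
    (M : Matrix (Fin m) (Fin n) A) (M' : Matrix (Fin m) (Fin n) B)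
    {s : ℕ} (a : Fin s → Fin m) (c : Fin s → Fin n)
    (hM : ∀ i j, φ (M (a i) (c j)) = M' (a i) (c j)) :
    φ (M.submatrix a c).det = (M'.submatrix a c).det := by
  rw [RingHom.map_det]
  congr 1
  ext i j
  exact hM i j

section Kill

variable {r : Fin m} {l : Fin n}

lemma kill_sg (b : (Fin m × Fin n) ⊕ (Fin m × Fin n)) : kill (some b) (sg m n k) = sg m n k :=
  kill_X_of_ne (by simp)

lemma kill_of_sg_mul {b : (Fin m × Fin n) ⊕ (Fin m × Fin n)} {F : MvPolynomial (Vxz m n) k}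
    (h : kill (some b) (sg m n k * F) = sg m n k * F) : kill (some b) F = F := by
  rw [map_mul, kill_sg] at h
  exact mul_left_cancel₀ sg_ne_zero h

lemma kill_inl_xm {i : Fin m} {j : Fin n} (h : (i, j) ≠ (r, l)) :
    kill (some (Sum.inl (r, l))) (xm m n k i j) = xm m n k i j :=
  kill_X_of_ne (by simpa using h)

lemma kill_inl_zm (i : Fin m) (j : Fin n) :
    kill (some (Sum.inl (r, l))) (zm m n k i j) = zm m n k i j :=
  kill_X_of_ne (by simp)

lemma kill_inl_ym {i : Fin m} {j : Fin n} (h : (i, j) ≠ (r, l)) :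
    kill (some (Sum.inl (r, l))) (ym m n k i j) = ym m n k i j := by
  rw [ym, map_add, map_mul, kill_sg, kill_inl_xm h, kill_inl_zm]

lemma kill_inr_xm (i : Fin m) (j : Fin n) :
    kill (some (Sum.inr (r, l))) (xm m n k i j) = xm m n k i j :=
  kill_X_of_ne (by simp)

lemma kill_inr_ym {i : Fin m} {j : Fin n} (h : (i, j) ≠ (r, l)) :
    kill (some (Sum.inr (r, l))) (ym m n k i j) = ym m n k i j := by
  rw [ym, map_add, map_mul, kill_sg, kill_inr_xm, zm, kill_X_of_ne (by simpa using h)]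

end Kill

section Points

variable {L : Type*} [Field L]

/-- The value of `X` at a point. -/
def xPart (x : Vxz m n → L) : Matrix (Fin m) (Fin n) L := fun i j => x (some (Sum.inl (i, j)))

/-- The value of `Y` at a point. -/
def yPart (x : Vxz m n → L) : Matrix (Fin m) (Fin n) L :=
  fun i j => x (some (Sum.inl (i, j))) + x none * x (some (Sum.inr (i, j)))

/-- The points with `σ ≠ 0` at which `X` and `Y` are degenerate. -/
def degPoints (L : Type*) [Field L] (R₁ : Finset (Fin m)) (t₁ : ℕ) (R₂ : Finset (Fin m))
    (t₂ : ℕ) : Set (Vxz m n → L) :=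
  {x | x none ≠ 0 ∧ Degenerate (xPart x) R₁ t₁ ∧ Degenerate (yPart x) R₂ t₂}

variable [Algebra k L]

lemma aeval_sg (x : Vxz m n → L) : aeval x (sg m n k) = x none := by simp [sg]

lemma aeval_xm (x : Vxz m n → L) (i : Fin m) (j : Fin n) :
    aeval x (xm m n k i j) = xPart x i j := by simp [xm, xPart]

lemma aeval_ym (x : Vxz m n → L) (i : Fin m) (j : Fin n) :
    aeval x (ym m n k i j) = yPart x i j := by simp [ym, xm, zm, sg, yPart]

lemma aeval_minor_xm (x : Vxz m n → L) {s : ℕ} (a : Fin s → Fin m) (c : Fin s → Fin n) :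
    aeval x ((xm m n k).submatrix a c).det = ((xPart x).submatrix a c).det :=
  map_minor (aeval x : MvPolynomial (Vxz m n) k →ₐ[k] L).toRingHom _ _ a c
    fun _ _ => aeval_xm x _ _

lemma aeval_minor_ym (x : Vxz m n → L) {s : ℕ} (a : Fin s → Fin m) (c : Fin s → Fin n) :
    aeval x ((ym m n k).submatrix a c).det = ((yPart x).submatrix a c).det :=
  map_minor (aeval x : MvPolynomial (Vxz m n) k →ₐ[k] L).toRingHom _ _ a c
    fun _ _ => aeval_ym x _ _

lemma aeval_eq_zero_of_mem_relIdeal {R₁ R₂ : Finset (Fin m)} {t₁ t₂ : ℕ}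
    {q : MvPolynomial (Vxz m n) k} (hq : q ∈ relIdeal m n k R₁ t₁ R₂ t₂) {x : Vxz m n → L}
    (hx : x ∈ degPoints L R₁ t₁ R₂ t₂) : aeval x q = 0 := by
  obtain ⟨h0, h1, h2⟩ := hx
  have : relIdeal m n k R₁ t₁ R₂ t₂ ≤ RingHom.ker (aeval x : MvPolynomial (Vxz m n) k →ₐ[k] L) := by
    refine Ideal.span_le.mpr ?_
    rintro g ((⟨s, a, c, hs, ha, hc, rfl⟩ | ⟨s, a, c, hs, ha, hc, rfl⟩) |
      ⟨-, s, a, c, hs, ha, hc, hF⟩)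
    · exact (aeval_minor_xm x a c).trans (h1.minor_eq_zero ⟨s, a, c, hs, ha, hc, rfl⟩)
    · exact (aeval_minor_ym x a c).trans (h2.minor_eq_zero ⟨s, a, c, hs, ha, hc, rfl⟩)
    · have := congrArg (aeval x) hF
      rw [map_mul, map_sub, aeval_minor_xm, aeval_minor_ym, aeval_sg,
        (h1.mono Finset.subset_union_left (min_le_left _ _)).minor_eq_zero
          ⟨s, a, c, hs, ha, hc, rfl⟩,
        (h2.mono Finset.subset_union_right (min_le_right _ _)).minor_eq_zero
          ⟨s, a, c, hs, ha, hc, rfl⟩, sub_zero] at this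
      exact (mul_eq_zero.mp this).resolve_left h0
  exact this hq

end Points

end Relations

section Induction

variable {m n : ℕ} {k L : Type*} [Field k] [Field L] [Algebra k L]

/-- Every polynomial vanishing on `degPoints` lies in `relIdeal`. -/
def VanishingMem (k L : Type*) [Field k] [Field L] [Algebra k L] (R₁ : Finset (Fin m)) (t₁ : ℕ)
    (R₂ : Finset (Fin m)) (t₂ : ℕ) : Prop :=
  ∀ p : MvPolynomial (Vxz m n) k, (∀ x ∈ degPoints L R₁ t₁ R₂ t₂, aeval x p = 0) →
    p ∈ relIdeal m n k R₁ t₁ R₂ t₂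

lemma cons_mem_of_mem_erase {R : Finset (Fin m)} {r : Fin m} (hr : r ∈ R) {s : ℕ}
    {a : Fin s → Fin m} (ha : ∀ i, a i ∈ R.erase r) (i : Fin (s + 1)) :
    (Fin.cons r a : Fin (s + 1) → Fin m) i ∈ R := by
  cases i using Fin.cases with
  | zero => simpa using hr
  | succ i => simpa using Finset.mem_of_mem_erase (ha i)

lemma cons_lt {l : Fin n} {t s : ℕ} (hl : (l : ℕ) < t) {c : Fin s → Fin n}
    (hc : ∀ j, (c j : ℕ) < l) (j : Fin (s + 1)) :
    ((Fin.cons l c : Fin (s + 1) → Fin n) j : ℕ) < t := by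
  cases j using Fin.cases with
  | zero => simpa using hl
  | succ j => simpa using (hc j).trans hl

lemma ne_of_coe_lt {l j : Fin n} (h : (j : ℕ) < l) : j ≠ l := fun e => by
  rw [e] at h; exact lt_irrefl _ h

lemma lift_gens_inl {R₁ R₂ : Finset (Fin m)} {r : Fin m} {l : Fin n} {t₂ : ℕ} (hr : r ∈ R₁)
    (hr₂ : r ∉ R₂ ∨ t₂ ≤ l) (hcase : r ∈ R₂ ∨ (l : ℕ) + 1 ≤ t₂ ∨ Disjoint R₁ R₂)
    {g : MvPolynomial (Vxz m n) k} (hg : g ∈ relGens m n k (R₁.erase r) l R₂ t₂) :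
    kill (some (Sum.inl (r, l))) g = g ∧ ∃ h, kill (some (Sum.inl (r, l))) h = h ∧
      X (some (Sum.inl (r, l))) * g + h ∈ relIdeal m n k R₁ (l + 1) R₂ t₂ := by
  have killX : ∀ {s : ℕ} (a : Fin s → Fin m) (c : Fin s → Fin n),
      (∀ i j, (a i, c j) ≠ (r, l)) → kill (some (Sum.inl (r, l))) ((xm m n k).submatrix a c).det
        = ((xm m n k).submatrix a c).det := fun a c h =>
    map_minor (kill _ : MvPolynomial (Vxz m n) k →ₐ[k] _).toRingHom _ _ a c
      fun i j => kill_inl_xm (h i j)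
  have killY : ∀ {s : ℕ} (a : Fin s → Fin m) (c : Fin s → Fin n),
      (∀ i j, (a i, c j) ≠ (r, l)) → kill (some (Sum.inl (r, l))) ((ym m n k).submatrix a c).det
        = ((ym m n k).submatrix a c).det := fun a c h =>
    map_minor (kill _ : MvPolynomial (Vxz m n) k →ₐ[k] _).toRingHom _ _ a c
      fun i j => kill_inl_ym (h i j)
  have killRX : ∀ {s : ℕ} (a : Fin s → Fin m) (c : Fin s → Fin n), (∀ i, a i ≠ r) →
      (∀ j, c j ≠ l) → kill (some (Sum.inl (r, l))) (bordRest (xm m n k) r l a c)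
        = bordRest (xm m n k) r l a c := fun a c ha hc =>
    map_bordRest (kill _ : MvPolynomial (Vxz m n) k →ₐ[k] _).toRingHom _ _ r l a c ha hc
      fun i j h => kill_inl_xm h
  have killRY : ∀ {s : ℕ} (a : Fin s → Fin m) (c : Fin s → Fin n), (∀ i, a i ≠ r) →
      (∀ j, c j ≠ l) → kill (some (Sum.inl (r, l))) (bordRest (ym m n k) r l a c)
        = bordRest (ym m n k) r l a c := fun a c ha hc =>
    map_bordRest (kill _ : MvPolynomial (Vxz m n) k →ₐ[k] _).toRingHom _ _ r l a c ha hc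
      fun i j h => kill_inl_ym h
  rcases hg with ((⟨s, a, c, hs, ha, hc, rfl⟩ | ⟨s, a, c, hs, ha, hc, rfl⟩) |
      ⟨hne, s, a, c, hs, ha, hc, hF⟩)
  · have ha' : ∀ i, a i ≠ r := fun i => Finset.ne_of_mem_erase (ha i)
    have hc' : ∀ j, c j ≠ l := fun j => ne_of_coe_lt (hc j)
    refine ⟨killX a c (by simp [ha']), bordRest (xm m n k) r l a c, killRX a c ha' hc', ?_⟩
    refine Ideal.subset_span (Or.inl (Or.inl ⟨s + 1, Fin.cons r a, Fin.cons l c, ?_,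
      cons_mem_of_mem_erase hr ha, cons_lt (Nat.lt_succ_self _) hc, (det_bord _ r l a c).symm⟩))
    rw [hs, Finset.card_erase_add_one hr]
  · refine ⟨killY a c fun i j h => ?_, 0, map_zero _, ?_⟩
    · obtain ⟨h1, h2⟩ := Prod.mk.inj h
      rcases hr₂ with h | h
      · exact h (h1 ▸ ha i)
      · exact absurd (h2 ▸ hc j) (not_lt.mpr h)
    · rw [add_zero]
      exact Ideal.mul_mem_left _ _
        (Ideal.subset_span (Or.inl (Or.inr ⟨s, a, c, hs, ha, hc, rfl⟩)))
  · have hcl : ∀ j, (c j : ℕ) < l := fun j => (hc j).trans_le (min_le_left _ _)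
    have hc' : ∀ j, c j ≠ l := fun j => ne_of_coe_lt (hcl j)
    have hkF : kill (some (Sum.inl (r, l))) g = g :=
      kill_of_sg_mul (by rw [hF, map_sub, killX a c (by simp [hc']), killY a c (by simp [hc'])])
    have hne' : (R₁ ∩ R₂).Nonempty :=
      hne.mono (Finset.inter_subset_inter_right (Finset.erase_subset _ _))
    refine ⟨hkF, ?_⟩
    by_cases hrR : r ∈ R₂
    · refine ⟨0, map_zero _, ?_⟩
      rw [add_zero]
      refine Ideal.mul_mem_left _ _ (Ideal.subset_span (Or.inr ⟨hne', ?_⟩))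
      have : R₁.erase r ∪ R₂ = R₁ ∪ R₂ := by
        ext i
        by_cases hi : i = r <;> simp [hi, hrR]
      rw [← this]
      exact diffs_mono _ (min_le_min (Nat.le_succ _) le_rfl) ⟨s, a, c, hs, ha, hc, hF⟩
    · have hlt : (l : ℕ) + 1 ≤ t₂ := by
        rcases hcase with h | h | h
        · exact absurd h hrR
        · exact h
        · rw [Finset.disjoint_iff_inter_eq_empty] at h
          simp [h] at hne'
      have hun : (R₁ ∪ R₂).erase r = R₁.erase r ∪ R₂ := by
        rw [Finset.erase_union_distrib, Finset.erase_eq_of_notMem hrR]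
      have hrU : r ∈ R₁ ∪ R₂ := Finset.mem_union_left _ hr
      rw [← hun] at ha hs
      have ha' : ∀ i, a i ≠ r := fun i => Finset.ne_of_mem_erase (ha i)
      obtain ⟨F, hF'⟩ := sg_dvd_minor_sub (k := k) (Fin.cons r a : Fin (s + 1) → Fin m)
        (Fin.cons l c : Fin (s + 1) → Fin n)
      refine ⟨F - X (some (Sum.inl (r, l))) * g, kill_of_sg_mul ?_, ?_⟩
      · have : sg m n k * (F - X (some (Sum.inl (r, l))) * g)
            = sg m n k * zm m n k r l * ((ym m n k).submatrix a c).det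
              + bordRest (ym m n k) r l a c - bordRest (xm m n k) r l a c := by
          rw [det_bord, det_bord] at hF'
          rw [mul_sub, ← hF', mul_left_comm, hF]
          simp only [ym, xm]
          ring
        rw [this, map_sub, map_add, map_mul, map_mul, kill_sg, kill_inl_zm,
          killY a c (by simp [hc']), killRY a c ha' hc', killRX a c ha' hc']
      · rw [add_sub_cancel]
        refine Ideal.subset_span (Or.inr ⟨hne', s + 1, Fin.cons r a, Fin.cons l c, ?_,
          cons_mem_of_mem_erase hrU ha, cons_lt (lt_min (Nat.lt_succ_self _) hlt) hcl, hF'.symm⟩)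
        rw [hs, Finset.card_erase_add_one hrU]

lemma lift_gens_inr {R : Finset (Fin m)} {r : Fin m} {l : Fin n} (hr : r ∈ R)
    {g : MvPolynomial (Vxz m n) k} (hg : g ∈ relGens m n k R (l + 1) (R.erase r) l) :
    kill (some (Sum.inr (r, l))) g = g ∧ ∃ h, kill (some (Sum.inr (r, l))) h = h ∧
      X (some (Sum.inr (r, l))) * g + h ∈ relIdeal m n k R (l + 1) R (l + 1) := by
  have killX : ∀ {s : ℕ} (a : Fin s → Fin m) (c : Fin s → Fin n),
      kill (some (Sum.inr (r, l))) ((xm m n k).submatrix a c).det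
        = ((xm m n k).submatrix a c).det := fun a c =>
    map_minor (kill _ : MvPolynomial (Vxz m n) k →ₐ[k] _).toRingHom _ _ a c
      fun i j => kill_inr_xm _ _
  have killY : ∀ {s : ℕ} (a : Fin s → Fin m) (c : Fin s → Fin n),
      (∀ j, c j ≠ l) → kill (some (Sum.inr (r, l))) ((ym m n k).submatrix a c).det
        = ((ym m n k).submatrix a c).det := fun a c h =>
    map_minor (kill _ : MvPolynomial (Vxz m n) k →ₐ[k] _).toRingHom _ _ a c
      fun i j => kill_inr_ym (by simp [h])
  have killRY : ∀ {s : ℕ} (a : Fin s → Fin m) (c : Fin s → Fin n), (∀ i, a i ≠ r) →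
      (∀ j, c j ≠ l) → kill (some (Sum.inr (r, l))) (bordRest (ym m n k) r l a c)
        = bordRest (ym m n k) r l a c := fun a c ha hc =>
    map_bordRest (kill _ : MvPolynomial (Vxz m n) k →ₐ[k] _).toRingHom _ _ r l a c ha hc
      fun i j h => kill_inr_ym h
  have hRR : (R ∩ R).Nonempty := ⟨r, by simpa using hr⟩
  rcases hg with ((⟨s, a, c, hs, ha, hc, rfl⟩ | ⟨s, a, c, hs, ha, hc, rfl⟩) |
      ⟨hne, s, a, c, hs, ha, hc, hF⟩)
  · refine ⟨killX a c, 0, map_zero _, ?_⟩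
    rw [add_zero]
    exact Ideal.mul_mem_left _ _
      (Ideal.subset_span (Or.inl (Or.inl ⟨s, a, c, hs, ha, hc, rfl⟩)))
  · have ha' : ∀ i, a i ≠ r := fun i => Finset.ne_of_mem_erase (ha i)
    have hc' : ∀ j, c j ≠ l := fun j => ne_of_coe_lt (hc j)
    obtain ⟨F, hF⟩ := sg_dvd_minor_sub (k := k) (Fin.cons r a : Fin (s + 1) → Fin m)
      (Fin.cons l c : Fin (s + 1) → Fin n)
    refine ⟨killY a c hc', F - X (some (Sum.inr (r, l))) * ((ym m n k).submatrix a c).det,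
      kill_of_sg_mul ?_, ?_⟩
    · have : sg m n k * (F - X (some (Sum.inr (r, l))) * ((ym m n k).submatrix a c).det)
          = xm m n k r l * ((ym m n k).submatrix a c).det + bordRest (ym m n k) r l a c
            - ((xm m n k).submatrix (Fin.cons r a : Fin (s + 1) → Fin m)
              (Fin.cons l c : Fin (s + 1) → Fin n)).det := by
        rw [det_bord (ym m n k)] at hF
        rw [mul_sub, ← hF]
        simp only [ym, zm]
        ring
      rw [this, map_sub, map_add, map_mul, kill_inr_xm, killX, killY a c hc', killRY a c ha' hc']
    · rw [add_sub_cancel]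
      refine Ideal.subset_span (Or.inr ⟨hRR, s + 1, Fin.cons r a, Fin.cons l c, ?_,
        fun i => Finset.mem_union_left _ (cons_mem_of_mem_erase hr ha i),
        cons_lt (lt_min (Nat.lt_succ_self _) (Nat.lt_succ_self _)) hc, hF.symm⟩)
      rw [hs, Finset.card_erase_add_one hr, Finset.union_self]
  · have hc' : ∀ j, c j ≠ l := fun j => ne_of_coe_lt ((hc j).trans_le (min_le_right _ _))
    refine ⟨kill_of_sg_mul (by rw [hF, map_sub, killX a c, killY a c hc']), 0, map_zero _, ?_⟩
    rw [add_zero]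
    refine Ideal.mul_mem_left _ _ (Ideal.subset_span (Or.inr ⟨hRR, ?_⟩))
    have : R ∪ R.erase r = R ∪ R := by
      rw [Finset.union_self, Finset.union_eq_left.mpr (Finset.erase_subset _ _)]
    rw [← this]
    exact diffs_mono _ (min_le_min le_rfl (Nat.le_succ _)) ⟨s, a, c, hs, ha, hc, hF⟩

/-- The direction moving `X` along `N` while keeping `Y` fixed. -/
def dirX (s : L) (N : Matrix (Fin m) (Fin n) L) : Vxz m n → L
  | none => 0
  | some (Sum.inl (i, j)) => N i j
  | some (Sum.inr (i, j)) => -N i j / s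

/-- The direction moving `Y` along `N` while keeping `X` fixed. -/
def dirY (s : L) (N : Matrix (Fin m) (Fin n) L) : Vxz m n → L
  | none => 0
  | some (Sum.inl _) => 0
  | some (Sum.inr (i, j)) => N i j / s

section Moves

variable {x : Vxz m n → L} {N : Matrix (Fin m) (Fin n) L} {r : Fin m} {l : Fin n} {T y : L}

lemma none_dirX : Function.update (x + T • dirX (x none) N) (some (Sum.inl (r, l))) y none
    = x none := by
  simp [dirX]

lemma none_dirY : Function.update (x + T • dirY (x none) N) (some (Sum.inr (r, l))) y none
    = x none := by
  simp [dirY]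

lemma xPart_dirX {i : Fin m} {j : Fin n} (h : (i, j) ≠ (r, l)) :
    xPart (Function.update (x + T • dirX (x none) N) (some (Sum.inl (r, l))) y) i j
      = xPart x i j + T * N i j := by
  rw [xPart, Function.update_of_ne (by simpa using h)]
  simp [dirX, xPart]

lemma xPart_dirX_self :
    xPart (Function.update (x + T • dirX (x none) N) (some (Sum.inl (r, l))) y) r l = y := by
  simp [xPart]

lemma yPart_dirX (hx : x none ≠ 0) {i : Fin m} {j : Fin n} (h : (i, j) ≠ (r, l)) :
    yPart (Function.update (x + T • dirX (x none) N) (some (Sum.inl (r, l))) y) i j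
      = yPart x i j := by
  rw [yPart, none_dirX, Function.update_of_ne (by simpa using h), Function.update_of_ne (by simp)]
  simp only [Pi.add_apply, Pi.smul_apply, dirX, smul_eq_mul, yPart]
  field_simp
  ring

lemma xPart_dirY :
    xPart (Function.update (x + T • dirY (x none) N) (some (Sum.inr (r, l))) y) = xPart x := by
  ext i j
  rw [xPart, Function.update_of_ne (by simp)]
  simp [dirY, xPart]

lemma yPart_dirY (hx : x none ≠ 0) {i : Fin m} {j : Fin n} (h : (i, j) ≠ (r, l)) :
    yPart (Function.update (x + T • dirY (x none) N) (some (Sum.inr (r, l))) y) i j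
      = yPart x i j + T * N i j := by
  rw [yPart, none_dirY, Function.update_of_ne (by simp), Function.update_of_ne (by simpa using h)]
  simp only [Pi.add_apply, Pi.smul_apply, dirY, smul_eq_mul, yPart]
  field_simp
  ring

lemma yPart_dirY_self :
    yPart (Function.update (x + T • dirY (x none) N) (some (Sum.inr (r, l))) y) r l
      = xPart x r l + x none * y := by
  rw [yPart, none_dirY, Function.update_of_ne (by simp), Function.update_self]
  simp [dirY, xPart]

end Moves

variable [Infinite L]

lemma VanishingMem.step_inl {R₁ R₂ : Finset (Fin m)} {r : Fin m} {l : Fin n} {t₂ : ℕ}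
    (hr : r ∈ R₁) (hr₂ : r ∉ R₂ ∨ t₂ ≤ l)
    (hcase : r ∈ R₂ ∨ (l : ℕ) + 1 ≤ t₂ ∨ Disjoint R₁ R₂)
    (h₁ : VanishingMem (n := n) k L (R₁.erase r) l R₂ t₂)
    (h₀ : VanishingMem (n := n) k L R₁ l R₂ t₂) :
    VanishingMem (n := n) k L R₁ (l + 1) R₂ t₂ := by
  have hY : ∀ {x : Vxz m n → L}, x none ≠ 0 → Degenerate (yPart x) R₂ t₂ → ∀ N (T y : L),
      Degenerate (yPart (Function.update (x + T • dirX (x none) N)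
        (some (Sum.inl (r, l))) y)) R₂ t₂ := fun hx h N T y => h.congr fun i hi j hj =>
    yPart_dirX hx fun e => by
      obtain ⟨h1, h2⟩ := Prod.mk.inj e
      rcases hr₂ with h | h
      · exact h (h1 ▸ hi)
      · exact absurd (h2 ▸ hj) (not_lt.mpr h)
  refine mem_of_vanishing (some (Sum.inl (r, l)))
    (fun q hq x hx => aeval_eq_zero_of_mem_relIdeal hq hx)
    (fun g hg => lift_gens_inl hr hr₂ hcase hg) h₁
    (fun p hp => relIdeal_mono (Nat.le_succ _) le_rfl (h₀ p hp)) ?_ ?_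
  · rintro x ⟨hx0, hx1, hx2⟩
    obtain ⟨N, hN⟩ := hx1.exists_corner hr
    refine ⟨dirX (x none) N, 1, 0, one_ne_zero, fun T hT => ⟨?_, ?_, hY hx0 hx2 _ _ _⟩⟩
    · rwa [none_dirX]
    · refine hN T hT _ (fun i j h => xPart_dirX h) ?_
      rw [xPart_dirX_self]
      simp
  · rintro x ⟨hx0, hx1, hx2⟩
    obtain ⟨N, hN⟩ := hx1.exists_entry hr
    refine ⟨dirX (x none) N, fun T hT => ?_⟩
    obtain ⟨y, hy⟩ := hN T hT
    refine ⟨y, ?_, hy _ (fun i j h => xPart_dirX h) xPart_dirX_self, hY hx0 hx2 _ _ _⟩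
    rwa [none_dirX]

lemma VanishingMem.step_inr {R : Finset (Fin m)} {r : Fin m} {l : Fin n} (hr : r ∈ R)
    (h₁ : VanishingMem (n := n) k L R (l + 1) (R.erase r) l)
    (h₀ : VanishingMem (n := n) k L R (l + 1) R l) :
    VanishingMem (n := n) k L R (l + 1) R (l + 1) := by
  refine mem_of_vanishing (some (Sum.inr (r, l)))
    (fun q hq x hx => aeval_eq_zero_of_mem_relIdeal hq hx)
    (fun g hg => lift_gens_inr hr hg) h₁
    (fun p hp => relIdeal_mono le_rfl (Nat.le_succ _) (h₀ p hp)) ?_ ?_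
  · rintro x ⟨hx0, hx1, hx2⟩
    obtain ⟨N, hN⟩ := hx2.exists_corner hr
    refine ⟨dirY (x none) N, 1 / x none, -xPart x r l / x none, one_div_ne_zero hx0,
      fun T hT => ⟨?_, ?_, hN T hT _ (fun i j h => yPart_dirY hx0 h) ?_⟩⟩
    · rwa [none_dirY]
    · rwa [xPart_dirY]
    · rw [yPart_dirY_self]
      field_simp
      ring
  · rintro x ⟨hx0, hx1, hx2⟩
    obtain ⟨N, hN⟩ := hx2.exists_entry hr
    refine ⟨dirY (x none) N, fun T hT => ?_⟩
    obtain ⟨y, hy⟩ := hN T hT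
    refine ⟨(y - xPart x r l) / x none, ?_, ?_, hy _ (fun i j h => yPart_dirY hx0 h) ?_⟩
    · rwa [none_dirY]
    · rwa [xPart_dirY]
    · rw [yPart_dirY_self]
      field_simp
      ring

end Induction

section MainInduction

variable {m n : ℕ} {k L : Type*} [Field k] [Field L] [Algebra k L]

/-- The images of the variables under the involution exchanging `X` and `Y`. -/
noncomputable def swapVar : Vxz m n → MvPolynomial (Vxz m n) k
  | none => sg m n k
  | some (Sum.inl (i, j)) => ym m n k i j
  | some (Sum.inr (i, j)) => -zm m n k i j

lemma aeval_swapVar_sg : aeval swapVar (sg m n k) = sg m n k := by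
  rw [sg, aeval_X]; rfl

lemma aeval_swapVar_xm (i : Fin m) (j : Fin n) : aeval swapVar (xm m n k i j) = ym m n k i j := by
  rw [xm, aeval_X]; rfl

lemma aeval_swapVar_zm (i : Fin m) (j : Fin n) :
    aeval swapVar (zm m n k i j) = -zm m n k i j := by
  rw [zm, aeval_X]; rfl

lemma aeval_swapVar_ym (i : Fin m) (j : Fin n) : aeval swapVar (ym m n k i j) = xm m n k i j := by
  rw [ym, map_add, map_mul, aeval_swapVar_sg, aeval_swapVar_xm, aeval_swapVar_zm, ym]
  ring

lemma aeval_swapVar_aeval_swapVar (p : MvPolynomial (Vxz m n) k) :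
    aeval (swapVar (k := k)) (aeval (swapVar (k := k)) p) = p := by
  have : (aeval (swapVar (k := k))).comp (aeval (swapVar (k := k)))
      = AlgHom.id k (MvPolynomial (Vxz m n) k) := by
    ext w
    rw [AlgHom.comp_apply, aeval_X]
    rcases w with _ | ⟨i, j⟩ | ⟨i, j⟩
    · exact congrArg _ aeval_swapVar_sg
    · exact congrArg _ (aeval_swapVar_ym i j)
    · rw [swapVar, map_neg, aeval_swapVar_zm, neg_neg]
      rfl
  exact DFunLike.congr_fun this p

lemma aeval_swapVar_mem {R₁ R₂ : Finset (Fin m)} {t₁ t₂ : ℕ} {q : MvPolynomial (Vxz m n) k}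
    (hq : q ∈ relIdeal m n k R₁ t₁ R₂ t₂) : aeval swapVar q ∈ relIdeal m n k R₂ t₂ R₁ t₁ := by
  have hX : ∀ {s : ℕ} (a : Fin s → Fin m) (c : Fin s → Fin n),
      aeval swapVar ((xm m n k).submatrix a c).det = ((ym m n k).submatrix a c).det := fun a c =>
    map_minor (aeval swapVar : MvPolynomial (Vxz m n) k →ₐ[k] _).toRingHom _ _ a c
      fun i j => aeval_swapVar_xm _ _
  have hY : ∀ {s : ℕ} (a : Fin s → Fin m) (c : Fin s → Fin n),
      aeval swapVar ((ym m n k).submatrix a c).det = ((xm m n k).submatrix a c).det := fun a c =>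
    map_minor (aeval swapVar : MvPolynomial (Vxz m n) k →ₐ[k] _).toRingHom _ _ a c
      fun i j => aeval_swapVar_ym _ _
  have : relIdeal m n k R₁ t₁ R₂ t₂ ≤ (relIdeal m n k R₂ t₂ R₁ t₁).comap
      (aeval swapVar : MvPolynomial (Vxz m n) k →ₐ[k] _) := by
    refine Ideal.span_le.mpr ?_
    rintro g ((⟨s, a, c, hs, ha, hc, rfl⟩ | ⟨s, a, c, hs, ha, hc, rfl⟩) |
      ⟨hne, s, a, c, hs, ha, hc, hF⟩)
    · exact Ideal.subset_span (Or.inl (Or.inr ⟨s, a, c, hs, ha, hc, hX a c⟩))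
    · exact Ideal.subset_span (Or.inl (Or.inl ⟨s, a, c, hs, ha, hc, hY a c⟩))
    · refine neg_mem_iff.mp (Ideal.subset_span (Or.inr ⟨by rwa [Finset.inter_comm], s, a, c,
        by rwa [Finset.union_comm], by rwa [Finset.union_comm], by rwa [min_comm], ?_⟩))
      have := congrArg (aeval (swapVar (k := k))) hF
      rw [map_mul, map_sub, hX, hY, aeval_swapVar_sg] at this
      rw [map_neg, mul_neg, this, neg_sub]
  exact this hq

lemma VanishingMem.swap {R₁ R₂ : Finset (Fin m)} {t₁ t₂ : ℕ}
    (h : VanishingMem (n := n) k L R₁ t₁ R₂ t₂) : VanishingMem (n := n) k L R₂ t₂ R₁ t₁ := by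
  intro p hp
  rw [← aeval_swapVar_aeval_swapVar p]
  refine aeval_swapVar_mem (h _ fun x ⟨hx0, hx1, hx2⟩ => ?_)
  have hcomp : aeval x (aeval (swapVar (k := k)) p) =
      aeval (fun w => aeval x (swapVar (k := k) w)) p := by
    rw [← AlgHom.comp_apply, comp_aeval]
  have h0 : aeval x (swapVar (m := m) (n := n) (k := k) none) = x none := aeval_sg x
  have h1 : xPart (fun w => aeval x (swapVar (k := k) w)) = yPart x := by
    ext i j
    exact aeval_ym x i j
  have h2 : yPart (fun w => aeval x (swapVar (k := k) w)) = xPart x := by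
    ext i j
    simp only [yPart, swapVar, aeval_sg, map_neg, aeval_ym, xPart, zm, aeval_X]
    ring
  rw [hcomp]
  refine hp _ ⟨h0.trans_ne hx0, by rwa [h1], by rwa [h2]⟩

lemma vanishingMem_zero [Infinite L] {R₁ R₂ : Finset (Fin m)} (h₁ : R₁.Nonempty)
    (h₂ : R₂.Nonempty) : VanishingMem (n := n) k L R₁ 0 R₂ 0 := by
  intro p hp
  have : MvPolynomial.map (algebraMap k L) (sg m n k * p) = 0 := by
    refine MvPolynomial.funext fun x => ?_
    rw [eval_map, ← aeval_def, map_mul, aeval_sg, map_zero]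
    by_cases hx : x none = 0
    · rw [hx, zero_mul]
    · rw [hp x ⟨hx, degenerate_zero _ h₁, degenerate_zero _ h₂⟩, mul_zero]
  rw [map_eq_zero_iff _ (map_injective _ (algebraMap k L).injective)] at this
  rw [(mul_eq_zero.mp this).resolve_left sg_ne_zero]
  exact zero_mem _

theorem vanishingMem [Infinite L] (R₁ R₂ : Finset (Fin m)) (t₁ t₂ : ℕ) (h₁ : t₁ ≤ n)
    (h₂ : t₂ ≤ n) : VanishingMem (n := n) k L R₁ t₁ R₂ t₂ := by
  induction hd : t₁ + t₂ using Nat.strong_induction_on generalizing R₁ R₂ t₁ t₂ with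
  | _ d ih =>
  subst hd
  rcases R₁.eq_empty_or_nonempty with rfl | hR₁
  · intro p _
    have : relIdeal m n k ∅ t₁ R₂ t₂ = ⊤ := (Ideal.eq_top_iff_one _).mpr
      (Ideal.subset_span (Or.inl (Or.inl (one_mem_minors_empty _ t₁))))
    rw [this]
    exact Submodule.mem_top
  rcases R₂.eq_empty_or_nonempty with rfl | hR₂
  · intro p _
    have : relIdeal m n k R₁ t₁ ∅ t₂ = ⊤ := (Ideal.eq_top_iff_one _).mpr
      (Ideal.subset_span (Or.inl (Or.inr (one_mem_minors_empty _ t₂))))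
    rw [this]
    exact Submodule.mem_top
  have stepX : ∀ (R R' : Finset (Fin m)) (r : Fin m) (t t' : ℕ), t + t' = t₁ + t₂ → t ≤ n →
      t' ≤ n → 1 ≤ t → r ∈ R → (r ∉ R' ∨ t' < t) → (r ∈ R' ∨ t ≤ t' ∨ Disjoint R R') →
      VanishingMem (n := n) k L R t R' t' := by
    intro R R' r t t' htt ht ht' h1 hr hr' hcase
    obtain ⟨l, rfl⟩ : ∃ l, t = l + 1 := ⟨t - 1, by omega⟩
    refine VanishingMem.step_inl (l := ⟨l, ht⟩) hr (hr'.imp_right Nat.lt_succ_iff.mp) hcase ?_ ?_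
    · exact ih (l + t') (by omega) _ _ _ _ (by omega) ht' rfl
    · exact ih (l + t') (by omega) _ _ _ _ (by omega) ht' rfl
  by_cases hdisj : Disjoint R₁ R₂
  · rcases Nat.eq_zero_or_pos t₁ with rfl | ht₁
    · rcases Nat.eq_zero_or_pos t₂ with rfl | ht₂
      · exact vanishingMem_zero hR₁ hR₂
      · obtain ⟨r, hr⟩ := hR₂
        exact (stepX R₂ R₁ r t₂ 0 (by omega) h₂ h₁ ht₂ hr
          (Or.inl (Finset.disjoint_right.mp hdisj hr)) (Or.inr (Or.inr hdisj.symm))).swap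
    · obtain ⟨r, hr⟩ := hR₁
      exact stepX R₁ R₂ r t₁ t₂ rfl h₁ h₂ ht₁ hr
        (Or.inl (Finset.disjoint_left.mp hdisj hr)) (Or.inr (Or.inr hdisj))
  obtain ⟨r, hr₁, hr₂⟩ := Finset.not_disjoint_iff.mp hdisj
  rcases lt_trichotomy t₁ t₂ with hlt | rfl | hlt
  · exact (stepX R₂ R₁ r t₂ t₁ (by omega) h₂ h₁ (by omega) hr₂ (Or.inr hlt) (Or.inl hr₁)).swap
  · rcases Nat.eq_zero_or_pos t₁ with rfl | ht
    · exact vanishingMem_zero hR₁ hR₂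
    by_cases h12 : R₁ ⊆ R₂
    · by_cases h21 : R₂ ⊆ R₁
      · obtain rfl := Finset.Subset.antisymm h12 h21
        obtain ⟨l, rfl⟩ : ∃ l, t₁ = l + 1 := ⟨t₁ - 1, by omega⟩
        refine VanishingMem.step_inr (l := ⟨l, h₁⟩) hr₁ ?_ ?_
        · exact ih (l + 1 + l) (by omega) _ _ _ _ h₁ (by omega) rfl
        · exact ih (l + 1 + l) (by omega) _ _ _ _ h₁ (by omega) rfl
      · obtain ⟨r', hr', hr''⟩ := Finset.not_subset.mp h21
        exact (stepX R₂ R₁ r' t₁ t₁ rfl h₁ h₁ ht hr' (Or.inl hr'') (Or.inr (Or.inl le_rfl))).swap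
    · obtain ⟨r', hr', hr''⟩ := Finset.not_subset.mp h12
      exact stepX R₁ R₂ r' t₁ t₁ rfl h₁ h₁ ht hr' (Or.inl hr'') (Or.inr (Or.inl le_rfl))
  · exact stepX R₁ R₂ r t₁ t₂ rfl h₁ h₂ (by omega) hr₁ (Or.inr hlt) (Or.inl hr₂)

end MainInduction

section MaxMinors

variable {m n : ℕ} {k τ : Type*} [Field k]

lemma minor_mem_of_injective {A : Type*} [CommRing A] {M : Matrix (Fin m) (Fin n) A}
    {J : Ideal A} {s t : ℕ} (hsm : s ≤ m)
    (h : ∀ c : Fin s → Fin n, StrictMono c → (∀ j, (c j : ℕ) < t) →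
      (M.submatrix (Fin.castLE hsm) c).det ∈ J)
    {a : Fin s → Fin m} {c : Fin s → Fin n} (ha : ∀ i, (a i : ℕ) < s) (hc : ∀ j, (c j : ℕ) < t) :
    (M.submatrix a c).det ∈ J := by
  by_cases hainj : Function.Injective a
  swap
  · simp only [Function.Injective, not_forall] at hainj
    obtain ⟨i, j, hij, hne⟩ := hainj
    rw [Matrix.det_zero_of_row_eq hne (funext fun l => by simp [hij])]
    exact J.zero_mem
  by_cases hcinj : Function.Injective c
  swap
  · simp only [Function.Injective, not_forall] at hcinj
    obtain ⟨i, j, hij, hne⟩ := hcinj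
    rw [Matrix.det_zero_of_column_eq hne fun l => by simp [hij]]
    exact J.zero_mem
  have hπ : Function.Bijective fun i : Fin s => (⟨a i, ha i⟩ : Fin s) :=
    Finite.injective_iff_bijective.mp fun i j hij => hainj (Fin.ext (by simpa using hij))
  have hsort : StrictMono (c ∘ Tuple.sort c) :=
    (Tuple.monotone_sort c).strictMono_of_injective (hcinj.comp (Tuple.sort c).injective)
  have hM : M.submatrix a c = ((M.submatrix (Fin.castLE hsm) (c ∘ Tuple.sort c)).submatrix
      (Equiv.ofBijective _ hπ) id).submatrix id (Tuple.sort c).symm := by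
    ext i j
    simp
  rw [hM, Matrix.det_permute', Matrix.det_permute]
  exact J.mul_mem_left _ (J.mul_mem_left _ (h _ hsort fun j => hc _))

lemma maxMinors_ent (hm : 0 < m) (hn : 0 < n) (w : Fin m × Fin n → τ) {s t : ℕ} (hs : 0 < s)
    (hsm : s ≤ m) :
    maxMinors k s t (fun i j => w (ent m n hm hn i j))
      = Ideal.span (minors (fun i j => (X (w (i, j)) : MvPolynomial τ k))
          (Finset.univ.filter fun i : Fin m => (i : ℕ) < s) t) := by
  have hcard : s = (Finset.univ.filter fun i : Fin m => (i : ℕ) < s).card := by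
    rw [Fin.card_filter_val_lt, min_eq_right hsm]
  refine le_antisymm (Ideal.span_le.mpr ?_) (Ideal.span_le.mpr ?_)
  · rintro d ⟨c, hmono, hc1, hcs, rfl⟩
    have hc : ∀ j : Fin s, 1 ≤ c (j + 1) ∧ c (j + 1) ≤ t := fun j =>
      ⟨hc1.trans (hmono.monotoneOn ⟨le_rfl, hs⟩ ⟨Nat.le_add_left 1 j, j.2⟩ (Nat.le_add_left 1 j)),
        (hmono.monotoneOn ⟨Nat.le_add_left 1 j, j.2⟩ ⟨hs, le_rfl⟩ j.2).trans hcs⟩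
    refine Ideal.subset_span ⟨s, fun i => ⟨(i + 1 - 1) % m, Nat.mod_lt _ hm⟩,
      fun j => ⟨(c (j + 1) - 1) % n, Nat.mod_lt _ hn⟩, hcard, fun i => ?_, fun j => ?_, rfl⟩
    · simp only [Finset.mem_filter, Finset.mem_univ, true_and, Nat.add_sub_cancel]
      exact (Nat.mod_le _ _).trans_lt i.2
    · have := hc j
      have := Nat.mod_le (c (j + 1) - 1) n
      simp only
      omega
  · rintro d ⟨s', a, c, hs', ha, hc, rfl⟩
    obtain rfl : s' = s := hs'.trans hcard.symm
    refine minor_mem_of_injective hsm (fun c hmono hc => ?_)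
      (fun i => (Finset.mem_filter.mp (ha i)).2) hc
    refine Ideal.subset_span ⟨fun j => if h : j - 1 < s' then c ⟨j - 1, h⟩ + 1 else 0, ?_, ?_, ?_, ?_⟩
    · rintro i ⟨hi1, hi2⟩ j ⟨hj1, hj2⟩ hij
      have hi : i - 1 < s' := by omega
      have hj : j - 1 < s' := by omega
      simp only [hi, hj, dif_pos]
      have : c ⟨i - 1, hi⟩ < c ⟨j - 1, hj⟩ := hmono (Fin.mk_lt_mk.mpr (by omega))
      exact Nat.succ_lt_succ this
    · simp [hs]
    · have : s' - 1 < s' := by omega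
      simp only [this, dif_pos]
      exact hc _
    · congr 1
      refine Matrix.ext fun i j => ?_
      change X (w (Fin.castLE hsm i, c j)) = _
      have he : (Fin.castLE hsm i, c j) = ent m n hm hn (i + 1) (c j + 1) :=
        Prod.ext (Fin.ext (by simp [ent, Nat.mod_eq_of_lt (i.2.trans_le hsm)]))
          (Fin.ext (by simp [ent, Nat.mod_eq_of_lt (c j).2]))
      simp only [Matrix.of_apply, Nat.add_sub_cancel, j.2, dif_pos, he]

lemma minors_subset_of_subset {A : Type*} [CommRing A] (M : Matrix (Fin m) (Fin n) A)
    {J : Ideal A} {R R' : Finset (Fin m)} {t : ℕ} (hR : R ⊆ R') (h : minors M R t ⊆ J) :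
    minors M R' t ⊆ J := by
  have step : ∀ (R : Finset (Fin m)) (r : Fin m), r ∉ R → minors M R t ⊆ J →
      minors M (insert r R) t ⊆ J := by
    rintro R r hr hJ d ⟨s, a, c, hs, ha, hc, rfl⟩
    rw [Finset.card_insert_of_notMem hr] at hs
    subst hs
    by_cases hra : ∃ i₀, a i₀ = r ∧ ∀ i, i ≠ i₀ → a i ≠ r
    · obtain ⟨i₀, hi₀, hne⟩ := hra
      rw [Matrix.det_succ_row _ i₀]
      refine J.sum_mem fun j _ => J.mul_mem_left _ (hJ ?_)
      rw [Matrix.submatrix_submatrix]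
      exact ⟨_, _, _, rfl, fun i => Finset.mem_of_mem_insert_of_ne (ha _)
        (hne _ (Fin.succAbove_ne i₀ i)), fun j => hc _, rfl⟩
    · have : ¬ Function.Injective a := fun hinj => hra <| by
        have himg : Finset.univ.image a = insert r R := by
          refine Finset.eq_of_subset_of_card_le (fun i hi => ?_) ?_
          · obtain ⟨j, _, rfl⟩ := Finset.mem_image.mp hi
            exact ha j
          · rw [Finset.card_image_of_injective _ hinj, Finset.card_univ, Fintype.card_fin,
              Finset.card_insert_of_notMem hr]
        obtain ⟨i₀, -, hi₀⟩ := Finset.mem_image.mp (himg ▸ Finset.mem_insert_self r R)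
        exact ⟨i₀, hi₀, fun i hi h => hi (hinj (h.trans hi₀.symm))⟩
      simp only [Function.Injective, not_forall] at this
      obtain ⟨i, j, hij, hne⟩ := this
      rw [Matrix.det_zero_of_row_eq hne (funext fun l => by simp [hij])]
      exact J.zero_mem
  have : ∀ T : Finset (Fin m), minors M (R ∪ T) t ⊆ J := by
    intro T
    induction T using Finset.induction_on with
    | empty => rwa [Finset.union_empty]
    | insert r T _ ih =>
      rw [Finset.union_insert]
      by_cases hr : r ∈ R ∪ T
      · rwa [Finset.insert_eq_of_mem hr]
      · exact step _ r hr ih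
  have := this R'
  rwa [Finset.union_eq_right.mpr hR] at this

end MaxMinors

section Symmetric

variable {S M : Type*} [CommRing S] [AddCommGroup M] [Module S M]

/-- The generators of `SymmetricAlg S M`. -/
noncomputable def symι : M →ₗ[S] SymmetricAlg S M :=
  (RingQuot.mkAlgHom S _).toLinearMap ∘ₗ TensorAlgebra.ι S

lemma symι_commute (x y : M) : Commute (symι x : SymmetricAlg S M) (symι y) := by
  have := RingQuot.mkAlgHom_rel S (s := fun a b : TensorAlgebra S M => ∃ x y : M,
    a = TensorAlgebra.ι S x * TensorAlgebra.ι S y ∧ b = TensorAlgebra.ι S y * TensorAlgebra.ι S x)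
    ⟨x, y, rfl, rfl⟩
  rw [map_mul, map_mul] at this
  exact this

lemma symAlg_induction {C : SymmetricAlg S M → Prop} (h₀ : ∀ r, C (algebraMap S _ r))
    (h₁ : ∀ x, C (symι x)) (hm : ∀ a b, C a → C b → C (a * b))
    (ha : ∀ a b, C a → C b → C (a + b)) (a : SymmetricAlg S M) : C a := by
  obtain ⟨a, rfl⟩ := RingQuot.mkAlgHom_surjective S _ a
  induction a using TensorAlgebra.induction with
  | algebraMap r => rw [AlgHom.commutes]; exact h₀ r
  | ι x => exact h₁ x
  | mul a b h h' => rw [map_mul]; exact hm _ _ h h'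
  | add a b h h' => rw [map_add]; exact ha _ _ h h'

lemma symAlg_mul_comm (a b : SymmetricAlg S M) : a * b = b * a := by
  change Commute a b
  induction b using symAlg_induction with
  | h₀ r => exact Algebra.commute_algebraMap_right _ _
  | h₁ x =>
    induction a using symAlg_induction with
    | h₀ r => exact Algebra.commute_algebraMap_left _ _
    | h₁ y => exact symι_commute y x
    | hm a b ha hb => exact ha.mul_left hb
    | ha a b ha hb => exact ha.add_left hb
  | hm b c hb hc => exact hb.mul_right hc
  | ha b c hb hc => exact hb.add_right hc

lemma exists_algHom_symmetricAlg : ∃ g : SymmetricAlgebra S M →ₐ[S] SymmetricAlg S M,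
    (∀ x, g (SymmetricAlgebra.ι S M x) = symι x) ∧ Function.Surjective g := by
  let _ : CommSemiring (SymmetricAlg S M) :=
    { (inferInstance : Semiring (SymmetricAlg S M)) with mul_comm := symAlg_mul_comm }
  refine ⟨SymmetricAlgebra.lift symι, fun x => SymmetricAlgebra.lift_ι_apply _ x, fun y => ?_⟩
  induction y using symAlg_induction with
  | h₀ r => exact ⟨algebraMap S _ r, AlgHom.commutes _ _⟩
  | h₁ x => exact ⟨SymmetricAlgebra.ι S M x, SymmetricAlgebra.lift_ι_apply _ x⟩
  | hm a b ha hb =>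
    obtain ⟨a, rfl⟩ := ha
    obtain ⟨b, rfl⟩ := hb
    exact ⟨a * b, map_mul _ _ _⟩
  | ha a b ha hb =>
    obtain ⟨a, rfl⟩ := ha
    obtain ⟨b, rfl⟩ := hb
    exact ⟨a + b, map_add _ _ _⟩

lemma symToRees_symι {D : Ideal S} (d : D) : symToRees D (symι d) = toRees D d := by
  simp [symToRees, symι]

lemma toRees_lift_surjective (D : Ideal S) :
    Function.Surjective (SymmetricAlgebra.lift (toRees D)) := by
  have h : reesAlgebra D ≤ ((reesAlgebra D).val.comp (SymmetricAlgebra.lift (toRees D))).range := by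
    refine (adjoin_monomial_eq_reesAlgebra D).ge.trans (Algebra.adjoin_le ?_)
    rintro _ ⟨d, hd, rfl⟩
    exact ⟨SymmetricAlgebra.ι S D ⟨d, hd⟩, by simp [toRees]⟩
  intro y
  obtain ⟨w, hw⟩ := h y.2
  exact ⟨w, Subtype.ext hw⟩

lemma symToRees_bijective_of_lift_injective {D : Ideal S}
    (h : ∀ w, SymmetricAlgebra.lift (toRees D) w = 0 → w = 0) :
    Function.Bijective (symToRees D) := by
  obtain ⟨g, hg, hsurj⟩ := exists_algHom_symmetricAlg (S := S) (M := D)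
  have hcomp : (symToRees D).comp g = SymmetricAlgebra.lift (toRees D) := by
    refine SymmetricAlgebra.algHom_ext (LinearMap.ext fun d => ?_)
    simp [hg, symToRees_symι]
  refine ⟨(injective_iff_map_eq_zero _).mpr fun y hy => ?_, fun y => ?_⟩
  · obtain ⟨w, rfl⟩ := hsurj y
    rw [h w (by rw [← hcomp]; exact hy), map_zero]
  · obtain ⟨w, rfl⟩ := toRees_lift_surjective D y
    exact ⟨g w, by rw [← hcomp]; rfl⟩

variable (D : Ideal S)

/-- The action of an element of `D` on pairs which produces the downgrading map. -/
noncomputable def downgradeStep :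
    D →ₗ[S] Module.End S (SymmetricAlgebra S D × SymmetricAlgebra S D) where
  toFun d := (LinearMap.mulRight S (SymmetricAlgebra.ι S D d) ∘ₗ LinearMap.fst S _ _).prod
    ((d : S) • LinearMap.fst S _ _)
  map_add' d d' := by
    ext <;> simp [mul_add, add_smul]
  map_smul' c d := by
    ext <;> simp [mul_smul]

lemma ι_smul_comm (d d' : D) :
    (d : S) • SymmetricAlgebra.ι S D d' = (d' : S) • SymmetricAlgebra.ι S D d := by
  rw [← map_smul, ← map_smul]
  congr 1
  exact Subtype.ext (mul_comm _ _)

/-- There is an `S`-linear map on the symmetric algebra of an ideal which sends `w * ι d` to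
`d • w`. -/
lemma exists_downgrade : ∃ f : SymmetricAlgebra S D →ₗ[S] SymmetricAlgebra S D,
    ∀ w (d : D), f (w * SymmetricAlgebra.ι S D d) = (d : S) • w := by
  obtain ⟨g, hg, -⟩ := exists_algHom_symmetricAlg (S := S) (M := D)
  let ρ : SymmetricAlg S D →ₐ[S] Module.End S (SymmetricAlgebra S D × SymmetricAlgebra S D) :=
    RingQuot.liftAlgHom S ⟨TensorAlgebra.lift S (downgradeStep D), by
      rintro a b ⟨d, d', rfl, rfl⟩
      rw [map_mul, map_mul, TensorAlgebra.lift_ι_apply, TensorAlgebra.lift_ι_apply]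
      refine LinearMap.ext fun p => Prod.ext (mul_right_comm _ _ _) ?_
      change (d : S) • (p.1 * SymmetricAlgebra.ι S D d')
        = (d' : S) • (p.1 * SymmetricAlgebra.ι S D d)
      rw [← mul_smul_comm, ι_smul_comm, mul_smul_comm]⟩
  have hρ : ∀ d, ρ (symι d) = downgradeStep D d := fun d => by simp [ρ, symι]
  have hfst : ∀ w p, (ρ (g w) p).1 = p.1 * w := by
    intro w
    induction w using SymmetricAlgebra.induction with
    | algebraMap r => intro p; simp [Algebra.smul_def, mul_comm]
    | ι d => intro p; rw [hg, hρ]; simp [downgradeStep]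
    | mul a b ha hb =>
      intro p
      rw [map_mul, map_mul, Module.End.mul_apply, ha, hb]
      ring
    | add a b ha hb =>
      intro p
      rw [map_add, map_add, LinearMap.add_apply, Prod.fst_add, ha, hb, mul_add]
  refine ⟨LinearMap.snd S _ _ ∘ₗ LinearMap.applyₗ (1, 0) ∘ₗ ρ.toLinearMap ∘ₗ g.toLinearMap,
    fun w d => ?_⟩
  have : ρ (g (w * SymmetricAlgebra.ι S D d)) (1, 0) = downgradeStep D d (ρ (g w) (1, 0)) := by
    rw [mul_comm, map_mul, map_mul, Module.End.mul_apply, hg, hρ]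
  change (ρ (g (w * SymmetricAlgebra.ι S D d)) (1, 0)).2 = _
  rw [this]
  change (d : S) • (ρ (g w) (1, 0)).1 = _
  rw [hfst, one_mul]

/-- The ideal defining the extended symmetric algebra `Sym(D)[σ] / (σ ι(d) - d)`. -/
noncomputable def extIdeal : Ideal (Polynomial (SymmetricAlgebra S D)) :=
  Ideal.span (Set.range fun d : D =>
    Polynomial.X * Polynomial.C (SymmetricAlgebra.ι S D d) - Polynomial.C (algebraMap S _ (d : S)))

lemma eq_zero_of_C_mem_extIdeal {w : SymmetricAlgebra S D} (hw : Polynomial.C w ∈ extIdeal D) :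
    w = 0 := by
  obtain ⟨f, hf⟩ := exists_downgrade D
  let Φ : Polynomial (SymmetricAlgebra S D) →ₗ[S] SymmetricAlgebra S D :=
    Polynomial.lsum fun a => f ^ a
  have hΦ : ∀ a w, Φ (Polynomial.monomial a w) = (f ^ a) w := fun a w => by
    simp [Φ, Polynomial.lsum, Polynomial.sum_monomial_index]
  have key : ∀ (d : D) (p : Polynomial (SymmetricAlgebra S D)),
      Φ (p * (Polynomial.X * Polynomial.C (SymmetricAlgebra.ι S D d)
        - Polynomial.C (algebraMap S _ (d : S)))) = 0 := by
    intro d p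
    induction p using Polynomial.induction_on' with
    | add p q hp hq => rw [add_mul, map_add, hp, hq, add_zero]
    | monomial a w =>
      have : Polynomial.monomial a w * (Polynomial.X * Polynomial.C (SymmetricAlgebra.ι S D d)
          - Polynomial.C (algebraMap S _ (d : S)))
          = Polynomial.monomial (a + 1) (w * SymmetricAlgebra.ι S D d)
            - Polynomial.monomial a ((d : S) • w) := by
        rw [mul_sub, ← mul_assoc, Polynomial.monomial_mul_X, Polynomial.monomial_mul_C,
          Polynomial.monomial_mul_C, Algebra.smul_def, mul_comm w (algebraMap _ _ _)]
      rw [this, map_sub, hΦ, hΦ, pow_succ, Module.End.mul_apply, hf, sub_self]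
  have hker : ∀ q ∈ extIdeal D, Φ q = 0 := by
    intro q hq
    obtain ⟨c, rfl⟩ := Finsupp.mem_ideal_span_range_iff_exists_finsupp.mp hq
    rw [Finsupp.sum, map_sum]
    exact Finset.sum_eq_zero fun d _ => key d _
  have := hker _ hw
  rwa [← Polynomial.monomial_zero_left, hΦ, pow_zero] at this

end Symmetric

section Extended

variable {S : Type*} [CommRing S] (D : Ideal S)

/-- The extended symmetric algebra of `D`. -/
abbrev ExtSym := Polynomial (SymmetricAlgebra S D) ⧸ extIdeal D

/-- The structure map of the extended symmetric algebra. -/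
noncomputable def extBase : S →+* ExtSym D :=
  (Ideal.Quotient.mk (extIdeal D)).comp
    (Polynomial.C.comp (algebraMap S (SymmetricAlgebra S D)))

/-- The parameter of the extended symmetric algebra. -/
noncomputable def extσ : ExtSym D := Ideal.Quotient.mk (extIdeal D) Polynomial.X

/-- The degree one generators of the extended symmetric algebra. -/
noncomputable def extι (d : D) : ExtSym D :=
  Ideal.Quotient.mk (extIdeal D) (Polynomial.C (SymmetricAlgebra.ι S D d))

lemma extι_add (d d' : D) : extι D (d + d') = extι D d + extι D d' := by
  simp [extι]

lemma extι_smul (s : S) (d : D) : extι D (s • d) = extBase D s * extι D d := by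
  simp [extι, extBase, Algebra.smul_def]

lemma extι_zero : extι D 0 = 0 := by
  simp [extι]

lemma extσ_mul_extι (d : D) : extσ D * extι D d = extBase D d := by
  rw [extσ, extι, ← map_mul]
  exact Ideal.Quotient.eq.mpr (Ideal.subset_span ⟨d, rfl⟩)

variable {D} {m n : ℕ} {k : Type*} [Field k] {φ : MvPolynomial (Vxy m n) k →+* S}

/-- The map to the extended symmetric algebra sending `X`, `Y` to their images in `S` and `Z` to
the generators of `D`. -/
noncomputable def toExt (hφ : ∀ b, φ (X (Sum.inr b)) - φ (X (Sum.inl b)) ∈ D) :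
    MvPolynomial (Vxz m n) k →+* ExtSym D :=
  eval₂Hom ((extBase D).comp (φ.comp C)) fun
    | none => extσ D
    | some (Sum.inl b) => extBase D (φ (X (Sum.inl b)))
    | some (Sum.inr b) => extι D ⟨_, hφ b⟩

variable (hφ : ∀ b, φ (X (Sum.inr b)) - φ (X (Sum.inl b)) ∈ D)

lemma toExt_C (a : k) : toExt hφ (C a) = extBase D (φ (C a)) := by
  simp [toExt]

lemma toExt_sg : toExt hφ (sg m n k) = extσ D := by
  simp [toExt, sg]

lemma toExt_xm (b : Fin m × Fin n) :
    toExt hφ (xm m n k b.1 b.2) = extBase D (φ (X (Sum.inl b))) := by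
  simp [toExt, xm]

lemma toExt_zm (b : Fin m × Fin n) : toExt hφ (zm m n k b.1 b.2) = extι D ⟨_, hφ b⟩ := by
  simp [toExt, zm]

lemma toExt_ym (b : Fin m × Fin n) :
    toExt hφ (ym m n k b.1 b.2) = extBase D (φ (X (Sum.inr b))) := by
  rw [ym, map_add, map_mul, toExt_sg, toExt_xm, toExt_zm, extσ_mul_extι, ← map_add,
    add_sub_cancel]

lemma toExt_aeval_xm (f : MvPolynomial (Fin m × Fin n) k) :
    toExt hφ (aeval (fun b => xm m n k b.1 b.2) f) = extBase D (φ (rename Sum.inl f)) := by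
  induction f using MvPolynomial.induction_on with
  | C a => rw [algHom_C, algebraMap_eq, toExt_C, rename_C]
  | add p q hp hq => simp only [map_add, hp, hq]
  | mul_X p b hp => simp only [map_mul, hp, aeval_X, toExt_xm, rename_X]

lemma toExt_aeval_ym (f : MvPolynomial (Fin m × Fin n) k) :
    toExt hφ (aeval (fun b => ym m n k b.1 b.2) f) = extBase D (φ (rename Sum.inr f)) := by
  induction f using MvPolynomial.induction_on with
  | C a => rw [algHom_C, algebraMap_eq, toExt_C, rename_C]
  | add p q hp hq => simp only [map_add, hp, hq]
  | mul_X p b hp => simp only [map_mul, hp, aeval_X, toExt_ym, rename_X]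

lemma exists_difference (f : MvPolynomial (Fin m × Fin n) k) :
    ∃ (F : MvPolynomial (Vxz m n) k) (d : D),
      sg m n k * F = aeval (fun b => ym m n k b.1 b.2) f - aeval (fun b => xm m n k b.1 b.2) f ∧
      (d : S) = φ (rename Sum.inr f) - φ (rename Sum.inl f) ∧ toExt hφ F = extι D d := by
  induction f using MvPolynomial.induction_on with
  | C a => exact ⟨0, 0, by simp, by simp, by rw [map_zero, extι_zero]⟩
  | add p q hp hq =>
    obtain ⟨F, d, h1, h2, h3⟩ := hp
    obtain ⟨G, e, h4, h5, h6⟩ := hq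
    refine ⟨F + G, d + e, ?_, ?_, ?_⟩
    · rw [mul_add, h1, h4, map_add, map_add]; ring
    · rw [Submodule.coe_add, h2, h5]; simp only [map_add]; ring
    · rw [map_add, h3, h6, extι_add]
  | mul_X p b hp =>
    obtain ⟨F, d, h1, h2, h3⟩ := hp
    refine ⟨F * ym m n k b.1 b.2 + aeval (fun b => xm m n k b.1 b.2) p * zm m n k b.1 b.2,
      φ (X (Sum.inr b)) • d + φ (rename Sum.inl p) • ⟨_, hφ b⟩, ?_, ?_, ?_⟩
    · rw [mul_add, ← mul_assoc, h1, map_mul, map_mul, aeval_X, aeval_X, ym]; ring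
    · simp only [Submodule.coe_add, Submodule.coe_smul, h2, map_mul, rename_X, smul_eq_mul]; ring
    · rw [map_add, map_mul, map_mul, h3, toExt_ym, toExt_zm, toExt_aeval_xm, extι_add, extι_smul,
        extι_smul, mul_comm (extι D d)]

/-- The generic matrix. -/
noncomputable def genericMatrix (m n : ℕ) (k : Type*) [Field k] :
    Matrix (Fin m) (Fin n) (MvPolynomial (Fin m × Fin n) k) := fun i j => X (i, j)

lemma aeval_genericMatrix_minor {A : Type*} [CommRing A] [Algebra k A]
    (M : Matrix (Fin m) (Fin n) A) {s : ℕ} (a : Fin s → Fin m) (c : Fin s → Fin n) :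
    aeval (fun b : Fin m × Fin n => M b.1 b.2) ((genericMatrix m n k).submatrix a c).det
      = (M.submatrix a c).det :=
  map_minor (aeval fun b : Fin m × Fin n => M b.1 b.2 :
    MvPolynomial (Fin m × Fin n) k →ₐ[k] A).toRingHom _ _ a c fun _ _ => aeval_X _ _

lemma toExt_eq_zero {R₁ R₂ : Finset (Fin m)} {t₁ t₂ : ℕ} (hR : R₂ ⊆ R₁)
    (hx : ∀ f ∈ minors (genericMatrix m n k) R₁ t₁, φ (rename Sum.inl f) = 0)
    (hy : ∀ f ∈ minors (genericMatrix m n k) R₂ t₂, φ (rename Sum.inr f) = 0)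
    {p : MvPolynomial (Vxz m n) k} (hp : p ∈ relIdeal m n k R₁ t₁ R₂ t₂) : toExt hφ p = 0 := by
  have : relIdeal m n k R₁ t₁ R₂ t₂ ≤ RingHom.ker (toExt hφ) := by
    refine Ideal.span_le.mpr ?_
    rintro g ((⟨s, a, c, hs, ha, hc, rfl⟩ | ⟨s, a, c, hs, ha, hc, rfl⟩) |
      ⟨-, s, a, c, hs, ha, hc, hF⟩)
    · rw [SetLike.mem_coe, RingHom.mem_ker, ← aeval_genericMatrix_minor (k := k), toExt_aeval_xm,
        hx _ ⟨s, a, c, hs, ha, hc, rfl⟩, map_zero]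
    · rw [SetLike.mem_coe, RingHom.mem_ker, ← aeval_genericMatrix_minor (k := k), toExt_aeval_ym,
        hy _ ⟨s, a, c, hs, ha, hc, rfl⟩, map_zero]
    · rw [Finset.union_eq_left.mpr hR] at hs ha
      obtain ⟨F, d, h1, h2, h3⟩ := exists_difference hφ ((genericMatrix m n k).submatrix a c).det
      have hmem : ((genericMatrix m n k).submatrix a c).det
          ∈ minors (genericMatrix m n k) R₁ (min t₁ t₂) := ⟨s, a, c, hs, ha, hc, rfl⟩
      have hy' : minors (genericMatrix m n k) R₁ t₂
          ⊆ RingHom.ker (φ.comp (rename Sum.inr).toRingHom) :=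
        minors_subset_of_subset _ hR fun f hf => hy f hf
      have h4 := hx _ (minors_mono _ _ (min_le_left _ _) hmem)
      have h5 : φ (rename Sum.inr ((genericMatrix m n k).submatrix a c).det) = 0 :=
        hy' (minors_mono _ _ (min_le_right _ _) hmem)
      rw [h4, h5, sub_zero] at h2
      rw [aeval_genericMatrix_minor, aeval_genericMatrix_minor, ← hF] at h1
      rw [SetLike.mem_coe, RingHom.mem_ker, ← mul_left_cancel₀ sg_ne_zero h1, h3,
        show d = 0 from Subtype.ext h2, extι_zero]
  exact this hp

/-- The presentation of the symmetric algebra of `D` by the generators `Y - X`. -/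
noncomputable def toSym (hφ : ∀ b, φ (X (Sum.inr b)) - φ (X (Sum.inl b)) ∈ D) :
    MvPolynomial (Vxy m n ⊕ (Fin m × Fin n)) k →+* SymmetricAlgebra S D :=
  eval₂Hom ((algebraMap S (SymmetricAlgebra S D)).comp (φ.comp C))
    (Sum.elim (fun v => algebraMap S _ (φ (X v)))
      fun b => SymmetricAlgebra.ι S D ⟨_, hφ b⟩)

/-- The substitution `Y = X + σ Z`. -/
noncomputable def substYZ :
    MvPolynomial (Vxy m n ⊕ (Fin m × Fin n)) k →ₐ[k] MvPolynomial (Vxz m n) k :=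
  aeval (Sum.elim (Sum.elim (fun b => xm m n k b.1 b.2) fun b => ym m n k b.1 b.2)
    fun b => zm m n k b.1 b.2)

lemma toExt_substYZ (q : MvPolynomial (Vxy m n ⊕ (Fin m × Fin n)) k) :
    toExt hφ (substYZ q) = Ideal.Quotient.mk (extIdeal D) (Polynomial.C (toSym hφ q)) := by
  induction q using MvPolynomial.induction_on with
  | C a =>
    rw [algHom_C, algebraMap_eq, toExt_C, toSym, eval₂Hom_C]
    rfl
  | add p q hp hq => simp only [map_add, hp, hq]
  | mul_X p b hp =>
    rw [map_mul, map_mul, map_mul, map_mul, map_mul, hp]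
    congr 1
    rw [substYZ, toSym, aeval_X, eval₂Hom_X']
    rcases b with (b | b) | b
    · exact toExt_xm hφ b
    · exact toExt_ym hφ b
    · exact toExt_zm hφ b

lemma toSym_surjective (hsurj : Function.Surjective φ)
    (hD : D ≤ Ideal.span (Set.range fun b => φ (X (Sum.inr b)) - φ (X (Sum.inl b)))) :
    Function.Surjective (toSym hφ) := by
  have hbase : ∀ s, ∃ q, toSym hφ q = algebraMap S _ s := by
    intro s
    obtain ⟨p, rfl⟩ := hsurj s
    refine ⟨rename Sum.inl p, ?_⟩
    induction p using MvPolynomial.induction_on with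
    | C a => rw [rename_C, toSym, eval₂Hom_C]; rfl
    | add p q hp hq => simp only [map_add, hp, hq]
    | mul_X p v hp =>
      rw [map_mul, map_mul, map_mul, map_mul, hp, rename_X]
      congr 1
      rw [toSym, eval₂Hom_X', Sum.elim_inl]
  intro w
  change w ∈ (toSym hφ).range
  induction w using SymmetricAlgebra.induction with
  | algebraMap s => exact hbase s
  | ι d =>
    obtain ⟨d, hd⟩ := d
    obtain ⟨c, rfl⟩ := Ideal.mem_span_range_iff_exists_fun.mp (hD hd)
    have : (⟨_, hd⟩ : D) = ∑ b, c b • ⟨_, hφ b⟩ := Subtype.ext (by simp)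
    rw [this, map_sum]
    refine Subring.sum_mem _ fun b _ => ?_
    rw [map_smul, Algebra.smul_def]
    refine Subring.mul_mem _ (hbase _) ⟨X (Sum.inr b), ?_⟩
    rw [toSym, eval₂Hom_X', Sum.elim_inr]
  | mul a b ha hb => exact Subring.mul_mem _ ha hb
  | add a b ha hb => exact Subring.add_mem _ ha hb

lemma aeval_substYZ {L : Type*} [Field L] [Algebra k L] {x : Vxz m n → L} (hx : x none ≠ 0)
    {η : S →+* L} (hη : ∀ p, η (φ p) = aeval (Sum.elim (fun b => xPart x b.1 b.2)
      fun b => yPart x b.1 b.2) p)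
    (q : MvPolynomial (Vxy m n ⊕ (Fin m × Fin n)) k) :
    aeval x (substYZ q) = Polynomial.eval₂ η (x none)⁻¹
      (SymmetricAlgebra.lift (toRees D) (toSym hφ q) : reesAlgebra D) := by
  induction q using MvPolynomial.induction_on with
  | C a =>
    rw [algHom_C, AlgHom.commutes, toSym, eval₂Hom_C, RingHom.comp_apply, AlgHom.commutes]
    change _ = Polynomial.eval₂ η _ (Polynomial.C (φ (C a)))
    rw [Polynomial.eval₂_C, hη, algHom_C]
  | add p q hp hq =>
    simp only [map_add, hp, hq, Subalgebra.coe_add, Polynomial.eval₂_add]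
  | mul_X p b hp =>
    simp only [map_mul, hp, Subalgebra.coe_mul, Polynomial.eval₂_mul]
    congr 1
    rw [substYZ, toSym, aeval_X, eval₂Hom_X']
    rcases b with (b | b) | b
    · simp only [Sum.elim_inl, AlgHom.commutes]
      change _ = Polynomial.eval₂ η _ (Polynomial.C (φ (X (Sum.inl b))))
      rw [Polynomial.eval₂_C, hη, aeval_X, aeval_xm, Sum.elim_inl]
    · simp only [Sum.elim_inl, Sum.elim_inr, AlgHom.commutes]
      change _ = Polynomial.eval₂ η _ (Polynomial.C (φ (X (Sum.inr b))))
      rw [Polynomial.eval₂_C, hη, aeval_X, aeval_ym, Sum.elim_inr]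
    · rw [Sum.elim_inr, Sum.elim_inr, SymmetricAlgebra.lift_ι_apply]
      change _ = Polynomial.eval₂ η _ (Polynomial.monomial 1 _)
      rw [Polynomial.eval₂_monomial, map_sub, hη, hη, aeval_X, aeval_X, zm, aeval_X, Sum.elim_inl,
        Sum.elim_inr, pow_one, eq_mul_inv_iff_mul_eq₀ hx, xPart, yPart]
      ring

/-- An ideal generated by the differences `Y - X` is of linear type as soon as `S` is presented by
minors of `X` and `Y` and has enough points. -/
theorem symToRees_bijective_of_points (L : Type*) [Field L] [Algebra k L] [Infinite L]
    {R₁ R₂ : Finset (Fin m)} {t₁ t₂ : ℕ} (ht₁ : t₁ ≤ n) (ht₂ : t₂ ≤ n) (hR : R₂ ⊆ R₁)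
    (hφ : ∀ b, φ (X (Sum.inr b)) - φ (X (Sum.inl b)) ∈ D)
    (hD : D ≤ Ideal.span (Set.range fun b => φ (X (Sum.inr b)) - φ (X (Sum.inl b))))
    (hsurj : Function.Surjective φ)
    (hx : ∀ f ∈ minors (genericMatrix m n k) R₁ t₁, φ (rename Sum.inl f) = 0)
    (hy : ∀ f ∈ minors (genericMatrix m n k) R₂ t₂, φ (rename Sum.inr f) = 0)
    (hpt : ∀ x ∈ degPoints L R₁ t₁ R₂ t₂, ∃ η : S →+* L, ∀ p, η (φ p) =
      aeval (Sum.elim (fun b => xPart x b.1 b.2) fun b => yPart x b.1 b.2) p) :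
    Function.Bijective (symToRees D) := by
  refine symToRees_bijective_of_lift_injective fun w hw => ?_
  obtain ⟨q, rfl⟩ := toSym_surjective hφ hsurj hD w
  refine eq_zero_of_C_mem_extIdeal D (Ideal.Quotient.eq_zero_iff_mem.mp ?_)
  rw [← toExt_substYZ]
  refine toExt_eq_zero hφ hR hx hy (vanishingMem (L := L) R₁ R₂ t₁ t₂ ht₁ ht₂ _ fun x hxm => ?_)
  obtain ⟨η, hη⟩ := hpt x hxm
  rw [aeval_substYZ hφ hxm.1 hη, hw, ZeroMemClass.coe_zero, Polynomial.eval₂_zero]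

end Extended

section Determinantal

variable {m n : ℕ} {k τ : Type*} [Field k]

lemma rename_minor_mem_maxMinors (hm : 0 < m) (hn : 0 < n) (w : Fin m × Fin n → τ) {s t : ℕ}
    (hs : 0 < s) (hsm : s ≤ m) {f : MvPolynomial (Fin m × Fin n) k}
    (hf : f ∈ minors (genericMatrix m n k) (Finset.univ.filter fun i : Fin m => (i : ℕ) < s) t) :
    rename w f ∈ maxMinors k s t (fun i j => w (ent m n hm hn i j)) := by
  rw [maxMinors_ent hm hn w hs hsm]
  obtain ⟨s', a, c, hs', ha, hc, rfl⟩ := hf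
  exact Ideal.subset_span ⟨s', a, c, hs', ha, hc,
    map_minor (rename w : MvPolynomial (Fin m × Fin n) k →ₐ[k] MvPolynomial τ k).toRingHom _ _ a c
      fun _ _ => rename_X _ _⟩

lemma aeval_eq_zero_of_mem_maxMinors {L : Type*} [Field L] [Algebra k L] (hm : 0 < m) (hn : 0 < n)
    (w : Fin m × Fin n → τ) {v : τ → L} {s t : ℕ} (hs : 0 < s) (hsm : s ≤ m)
    (h : Degenerate (fun i j => v (w (i, j))) (Finset.univ.filter fun i : Fin m => (i : ℕ) < s) t)
    {p : MvPolynomial τ k} (hp : p ∈ maxMinors k s t (fun i j => w (ent m n hm hn i j))) :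
    aeval v p = 0 := by
  rw [maxMinors_ent hm hn w hs hsm] at hp
  have : Ideal.span (minors (fun i j => (X (w (i, j)) : MvPolynomial τ k))
      (Finset.univ.filter fun i : Fin m => (i : ℕ) < s) t)
      ≤ RingHom.ker (aeval v : MvPolynomial τ k →ₐ[k] L) := by
    refine Ideal.span_le.mpr ?_
    rintro _ ⟨s', a, c, hs', ha, hc, rfl⟩
    refine (map_minor (aeval v : MvPolynomial τ k →ₐ[k] L).toRingHom _
      (fun i j => v (w (i, j))) a c fun _ _ => aeval_X _ _).trans ?_
    exact h.minor_eq_zero ⟨s', a, c, hs', ha, hc, rfl⟩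
  exact this hp

end Determinantal

/-- **Linear type.**  The diagonal ideal `𝔻` is of linear type: the canonical surjection from
the symmetric algebra `Sym_S(𝔻)` onto the Rees algebra `R(𝔻)` is an isomorphism. -/
theorem diagIdeal_isLinearType (k : Type*) [Field k] (m n s₁ s₂ t₁ t₂ : ℕ)
    (hm2 : 2 ≤ m) (hmn : m ≤ n) (hs2 : 2 ≤ s₂) (hs21 : s₂ ≤ s₁) (hs1m : s₁ ≤ m)
    (hs1t1 : s₁ ≤ t₁) (ht1n : t₁ ≤ n) (hs2t2 : s₂ ≤ t₂) (ht2n : t₂ ≤ n)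
    (hm : 0 < m) (hn : 0 < n) :
    Function.Bijective (symToRees (diagIdeal k m n s₁ s₂ t₁ t₂ hm hn)) := by
  have hs₂ : 0 < s₂ := by omega
  have hs₁ : 0 < s₁ := by omega
  refine symToRees_bijective_of_points (AlgebraicClosure k) ht1n ht2n
    (R₁ := Finset.univ.filter fun i : Fin m => (i : ℕ) < s₁)
    (R₂ := Finset.univ.filter fun i : Fin m => (i : ℕ) < s₂)
    (φ := Ideal.Quotient.mk _) (fun i hi => ?_) (fun b => ?_) (Ideal.span_le.mpr ?_)
    Ideal.Quotient.mk_surjective (fun f hf => ?_) (fun f hf => ?_) fun x hx => ?_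
  · exact Finset.mem_filter.mpr ⟨Finset.mem_univ i, (Finset.mem_filter.mp hi).2.trans_le hs21⟩
  · have hb : ent m n hm hn (b.1 + 1) (b.2 + 1) = b :=
      Prod.ext (Fin.ext (by simp [ent, Nat.mod_eq_of_lt b.1.2]))
        (Fin.ext (by simp [ent, Nat.mod_eq_of_lt b.2.2]))
    rw [← neg_mem_iff, neg_sub, ← map_sub]
    exact Ideal.subset_span ⟨b.1 + 1, b.2 + 1, Nat.le_add_left 1 _, b.1.2, Nat.le_add_left 1 _,
      b.2.2, by rw [hb]⟩
  · rintro _ ⟨i, j, -, -, -, -, rfl⟩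
    rw [SetLike.mem_coe, ← neg_mem_iff, ← map_neg, neg_sub, map_sub]
    exact Ideal.subset_span ⟨ent m n hm hn i j, rfl⟩
  · exact Ideal.Quotient.eq_zero_iff_mem.mpr (Ideal.mem_sup_left
      (rename_minor_mem_maxMinors hm hn Sum.inl hs₁ hs1m hf))
  · exact Ideal.Quotient.eq_zero_iff_mem.mpr (Ideal.mem_sup_right
      (rename_minor_mem_maxMinors hm hn Sum.inr hs₂ (hs21.trans hs1m) hf))
  · obtain ⟨-, hX, hY⟩ := hx
    let ε : MvPolynomial (Vxy m n) k →ₐ[k] AlgebraicClosure k :=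
      aeval (Sum.elim (fun b => xPart x b.1 b.2) fun b => yPart x b.1 b.2)
    have hker : maxMinors k s₁ t₁ (fun i j => (Sum.inl (ent m n hm hn i j) : Vxy m n)) ⊔
        maxMinors k s₂ t₂ (fun i j => (Sum.inr (ent m n hm hn i j) : Vxy m n))
        ≤ RingHom.ker ε :=
      sup_le
        (fun p hp => aeval_eq_zero_of_mem_maxMinors hm hn Sum.inl hs₁ hs1m hX hp)
        (fun p hp => aeval_eq_zero_of_mem_maxMinors hm hn Sum.inr hs₂ (hs21.trans hs1m) hY hp)
    exact ⟨Ideal.Quotient.lift _ ε.toRingHom fun p hp => hker hp,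
      fun p => Ideal.Quotient.lift_mk _ _ _⟩
end

section
/- Let R = k[x_{1,1},…,x_{1,n},x_{2,1},…,x_{2,n}] with k a field and n ≥ 1. Then ⋂_{1 ≤ a ≤ b ≤ n} (x_{1a}, x_{2b}) equals the ideal generated by the monomials (∏_{i=1}^{u} x_{1i})(∏_{i=u+1}^{n} x_{2i}) for 0 ≤ u ≤ n (empty products equal 1); equivalently, the Alexander dual of the ideal ({x_{1a}x_{2b} : 1 ≤ a ≤ b ≤ n}) is ({(∏_{i=1}^{u} x_{1i})(∏_{i=u+1}^{n} x_{2i}) : 0 ≤ u ≤ n}). -/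
open MvPolynomial Finset

theorem prod_X_dvd_monomial {σ ι R : Type*} [CommSemiring R] {s : Finset ι} {f : ι → σ}
    (hf : Set.InjOn f s) {m : σ →₀ ℕ} (hm : ∀ i ∈ s, m (f i) ≠ 0) (c : R) :
    ∏ i ∈ s, (X (f i) : MvPolynomial σ R) ∣ monomial m c := by
  classical
  have hprod : ∏ i ∈ s, (X (f i) : MvPolynomial σ R) =
      monomial (∑ i ∈ s, Finsupp.single (f i) 1) 1 := by
    rw [monomial_sum_one]
    rfl
  rw [hprod, monomial_dvd_monomial]
  refine ⟨Or.inr fun j => ?_, one_dvd c⟩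
  rw [Finsupp.finsetSum_apply]
  by_cases hj : ∃ i ∈ s, f i = j
  · obtain ⟨i, hi, rfl⟩ := hj
    rw [Finset.sum_eq_single_of_mem i hi fun b hb hbi =>
      Finsupp.single_eq_of_ne fun h => hbi (hf hb hi h.symm)]
    simpa [Nat.one_le_iff_ne_zero] using hm i hi
  · push Not at hj
    rw [Finset.sum_eq_zero fun i hi => Finsupp.single_eq_of_ne (hj i hi).symm]
    exact Nat.zero_le _

theorem mem_span_pair_X {σ R : Type*} [CommSemiring R] {i j : σ} {f : MvPolynomial σ R} :
    f ∈ Ideal.span {(X i : MvPolynomial σ R), X j} ↔ ∀ m ∈ f.support, m i ≠ 0 ∨ m j ≠ 0 := by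
  rw [← Set.image_pair, mem_ideal_span_X_image]
  simp

/-- If one of `P a`, `Q b` holds whenever `1 ≤ a ≤ b ≤ n`, then `P` holds on an initial segment of
`[1, n]` and `Q` on the complementary final segment. -/
theorem exists_threshold {P Q : ℕ → Prop} (n : ℕ)
    (h : ∀ a b, 1 ≤ a → a ≤ b → b ≤ n → P a ∨ Q b) :
    ∃ u ≤ n, (∀ i, 1 ≤ i → i ≤ u → P i) ∧ ∀ i, u < i → i ≤ n → Q i := by
  classical
  by_cases hP : ∃ a, 1 ≤ a ∧ a ≤ n ∧ ¬ P a
  · obtain ⟨h1, hn, hnot⟩ := Nat.find_spec hP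
    refine ⟨Nat.find hP - 1, by omega, fun i hi hiu => ?_, fun i hui hin => ?_⟩
    · by_contra hPi
      exact Nat.find_min hP (m := i) (by omega) ⟨hi, by omega, hPi⟩
    · exact (h _ i h1 (by omega) hin).resolve_left hnot
  · push Not at hP
    exact ⟨n, le_rfl, hP, fun i hui hin => by omega⟩

theorem ent_snd_injOn (m n : ℕ) (hm : 0 < m) (hn : 0 < n) (r : ℕ → ℕ) :
    Set.InjOn (fun i => ent m n hm hn (r i) i) (Finset.Icc 1 n : Finset ℕ) := by
  intro i hi j hj hij
  simp only [Finset.coe_Icc, Set.mem_Icc] at hi hj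
  have h : (i - 1) % n = (j - 1) % n := congrArg (fun p => (p.2 : ℕ)) hij
  rw [Nat.mod_eq_of_lt (by omega), Nat.mod_eq_of_lt (by omega)] at h
  omega

theorem prod_Icc_ite {M : Type*} [CommMonoid M] (g : ℕ → ℕ → M) {u n : ℕ} (hu : u ≤ n) :
    ∏ i ∈ Finset.Icc 1 n, g (if i ≤ u then 1 else 2) i =
      (∏ i ∈ Finset.Icc 1 u, g 1 i) * ∏ i ∈ Finset.Icc (u + 1) n, g 2 i := by
  have hunion : Finset.Icc 1 n = Finset.Icc 1 u ∪ Finset.Icc (u + 1) n := by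
    ext i
    simp only [Finset.mem_union, Finset.mem_Icc]
    omega
  have hdisj : Disjoint (Finset.Icc 1 u) (Finset.Icc (u + 1) n) := by
    rw [Finset.disjoint_left]
    intro i hi hi'
    rw [Finset.mem_Icc] at hi hi'
    omega
  rw [hunion, Finset.prod_union hdisj]
  congr 1 <;> refine Finset.prod_congr rfl fun i hi => ?_
  · rw [if_pos (Finset.mem_Icc.mp hi).2]
  · rw [if_neg (by have := (Finset.mem_Icc.mp hi).1; omega)]

/-- In `k[x_{1,1},…,x_{1,n},x_{2,1},…,x_{2,n}]` we have
`⋂_{1 ≤ a ≤ b ≤ n} (x_{1a}, x_{2b}) = ({(∏_{i=1}^{u} x_{1i})(∏_{i=u+1}^{n} x_{2i}) : 0 ≤ u ≤ n})`;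
i.e. the Alexander dual of `({x_{1a}x_{2b} : 1 ≤ a ≤ b ≤ n})` is the right-hand ideal. -/
theorem alexanderDual_two_rows (k : Type*) [Field k] (n : ℕ) (hn : 1 ≤ n) :
    (⨅ (a : ℕ) (b : ℕ) (_ : 1 ≤ a ∧ a ≤ b ∧ b ≤ n),
      Ideal.span {(X (ent 2 n (by omega) (by omega) 1 a) : MvPolynomial (Fin 2 × Fin n) k),
        X (ent 2 n (by omega) (by omega) 2 b)}) =
    Ideal.span {g : MvPolynomial (Fin 2 × Fin n) k | ∃ u : ℕ, u ≤ n ∧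
      g = (∏ i ∈ Finset.Icc 1 u, X (ent 2 n (by omega) (by omega) 1 i)) *
          ∏ i ∈ Finset.Icc (u + 1) n, X (ent 2 n (by omega) (by omega) 2 i)} := by
  apply le_antisymm
  · intro f hf
    simp only [Submodule.mem_iInf, mem_span_pair_X] at hf
    rw [f.as_sum]
    refine Ideal.sum_mem _ fun m hm => ?_
    obtain ⟨u, hu, h₁, h₂⟩ := exists_threshold
      (P := fun a => m (ent 2 n (by omega) (by omega) 1 a) ≠ 0)
      (Q := fun b => m (ent 2 n (by omega) (by omega) 2 b) ≠ 0)
      n fun a b ha hab hb => hf a b ⟨ha, hab, hb⟩ m hm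
    refine Ideal.mem_of_dvd _ ?_ (Ideal.subset_span ⟨u, hu, rfl⟩)
    rw [← prod_Icc_ite (fun r i => X (ent 2 n (by omega) (by omega) r i)) hu]
    refine prod_X_dvd_monomial (ent_snd_injOn 2 n _ _ _) (fun i hi => ?_) _
    rw [Finset.mem_Icc] at hi
    split_ifs with hiu
    · exact h₁ i hi.1 hiu
    · exact h₂ i (by omega) hi.2
  · rw [Ideal.span_le]
    rintro _ ⟨u, hu, rfl⟩
    simp only [SetLike.mem_coe, Submodule.mem_iInf]
    rintro a b ⟨ha, hab, hb⟩
    by_cases hau : a ≤ u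
    · refine Ideal.mul_mem_right _ _ (Ideal.mem_of_dvd _
        (Finset.dvd_prod_of_mem _ (Finset.mem_Icc.mpr ⟨ha, hau⟩)) (Ideal.subset_span ?_))
      simp
    · refine Ideal.mul_mem_left _ _ (Ideal.mem_of_dvd _
        (Finset.dvd_prod_of_mem _ (Finset.mem_Icc.mpr ⟨by omega, hb⟩)) (Ideal.subset_span ?_))
      simp
end

section
/- Let k be a field and m ≥ 2; work in R = k[x_{ij} : 1 ≤ i, j ≤ m]. Then ⋂ (x_{1a_1}, x_{2a_2}, …, x_{m a_m}), the intersection taken over all sequences with 1 ≤ a_1 ≤ a_2 < a_3 < ⋯ < a_m ≤ m, equals the ideal generated by: x_{11}x_{12}; the products x_{11}x_{ii} for 2 ≤ i ≤ m; and the products x_{i,i−1}x_{jj} for 2 ≤ i ≤ m and i ≤ j ≤ m. Equivalently, this ideal equals ({x_{i,i−1}·(x_{ii}, x_{i+1,i+1}, …, x_{mm}) : 2 ≤ i ≤ m}) + x_{11}·(x_{12}, x_{22}, x_{33}, …, x_{mm}). -/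
open MvPolynomial Finset

/-- A monomial divisible by two distinct variables lies in every ideal containing their product. -/
theorem monomial_mem_of_X_mul_X_mem {σ R : Type*} [CommSemiring R] {I : Ideal (MvPolynomial σ R)}
    {p q : σ} (hpq : p ≠ q) (hI : X p * X q ∈ I) {d : σ →₀ ℕ} (hp : d p ≠ 0) (hq : d q ≠ 0)
    (c : R) : monomial d c ∈ I := by
  classical
  have hle : Finsupp.single p 1 + Finsupp.single q 1 ≤ d := by
    intro x
    by_cases hxp : x = p
    · subst hxp
      simp [hpq.symm, Nat.one_le_iff_ne_zero, hp]
    · by_cases hxq : x = q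
      · subst hxq
        simp [hpq, Nat.one_le_iff_ne_zero, hq]
      · simp [Ne.symm hxp, Ne.symm hxq]
  have hd : monomial d c =
      monomial (d - (Finsupp.single p 1 + Finsupp.single q 1)) c * (X p * X q) := by
    simp only [X, monomial_mul, mul_one]
    rw [tsub_add_cancel_of_le hle]
  rw [hd]
  exact I.mul_mem_left _ hI

/-- A sequence increasing strictly on `[2, m]` grows at least linearly there. -/
theorem add_sub_le_of_lt_succ {m : ℕ} {a : ℕ → ℕ} (h : ∀ i, 2 ≤ i → i < m → a i < a (i + 1))
    {i j : ℕ} (hi : 2 ≤ i) (hij : i ≤ j) (hj : j ≤ m) : a i + (j - i) ≤ a j := by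
  induction j, hij using Nat.le_induction with
  | base => simp
  | succ n hn ih =>
    have h1 := ih (by omega)
    have h2 := h n (by omega) (by omega)
    omega

theorem ent_ne_ent {m n : ℕ} {hm : 0 < m} {hn : 0 < n} {i j i' j' : ℕ}
    (hj : 1 ≤ j) (hjn : j ≤ n) (hj' : 1 ≤ j') (hjn' : j' ≤ n)
    (hi : 1 ≤ i) (him : i ≤ m) (hi' : 1 ≤ i') (him' : i' ≤ m) (hne : i ≠ i' ∨ j ≠ j') :
    ent m n hm hn i j ≠ ent m n hm hn i' j' := by
  intro h
  simp only [ent, Prod.mk.injEq, Fin.mk.injEq] at h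
  rw [Nat.mod_eq_of_lt (by omega), Nat.mod_eq_of_lt (by omega), Nat.mod_eq_of_lt (by omega),
    Nat.mod_eq_of_lt (by omega)] at h
  omega

/-- A set of cells meeting every sequence `1 ≤ a₁ ≤ a₂ < ⋯ < a_m ≤ m` contains both cells of one
of the generating products. -/
theorem exists_pair_of_forall_sequence_meets {m : ℕ} (hm : 2 ≤ m) (T : ℕ → ℕ → Prop)
    (hT : ∀ a : ℕ → ℕ, 1 ≤ a 1 → a 1 ≤ a 2 → (∀ i, 2 ≤ i → i < m → a i < a (i + 1)) → a m ≤ m →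
      ∃ r, 1 ≤ r ∧ r ≤ m ∧ T r (a r)) :
    (T 1 1 ∧ T 1 2) ∨ (∃ i, 2 ≤ i ∧ i ≤ m ∧ T 1 1 ∧ T i i) ∨
      ∃ i j, 2 ≤ i ∧ i ≤ m ∧ i ≤ j ∧ j ≤ m ∧ T i (i - 1) ∧ T j j := by
  classical
  by_cases h11 : T 1 1
  · obtain ⟨r, hr1, hrm, hr⟩ := hT (fun i => if i = 1 then 2 else i) (by simp) (by simp)
      (by intro i hi _; split_ifs <;> omega) (by split_ifs <;> omega)
    by_cases h : r = 1
    · subst h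
      exact Or.inl ⟨h11, by simpa using hr⟩
    · exact Or.inr (Or.inl ⟨r, by omega, hrm, h11, by simpa [h] using hr⟩)
  · have step : ∀ s, 2 ≤ s → ∃ r, 2 ≤ r ∧ r ≤ m ∧ ((r < s ∧ T r (r - 1)) ∨ (s ≤ r ∧ T r r)) := by
      intro s hs
      obtain ⟨r, hr1, hrm, hr⟩ := hT (fun i => if i = 1 then 1 else if i < s then i - 1 else i)
        (by simp) (by split_ifs <;> omega)
        (by intro i hi _; split_ifs <;> omega) (by split_ifs <;> omega)
      by_cases h : r = 1
      · subst h
        exact absurd (by simpa using hr) h11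
      · refine ⟨r, by omega, hrm, ?_⟩
        by_cases hrs : r < s
        · exact Or.inl ⟨hrs, by simpa [h, hrs] using hr⟩
        · exact Or.inr ⟨by omega, by simpa [h, hrs] using hr⟩
    have hex : ∃ i, 2 ≤ i ∧ i ≤ m ∧ T i (i - 1) := by
      obtain ⟨r, h2, hrm, ⟨_, h⟩ | ⟨h, _⟩⟩ := step (m + 1) (by omega)
      · exact ⟨r, h2, hrm, h⟩
      · omega
    obtain ⟨h2, him, hi⟩ := Nat.find_spec hex
    obtain ⟨r, hr2, hrm, ⟨hlt, h⟩ | ⟨hle, h⟩⟩ := step (Nat.find hex) h2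
    · exact absurd ⟨hr2, hrm, h⟩ (Nat.find_min hex hlt)
    · exact Or.inr (Or.inr ⟨_, r, h2, him, hle, hrm, hi, h⟩)

/-- In `k[x_{ij} : 1 ≤ i, j ≤ m]`, the intersection `⋂ (x_{1a₁}, x_{2a₂}, …, x_{ma_m})` over
all sequences `1 ≤ a₁ ≤ a₂ < a₃ < ⋯ < a_m ≤ m` equals the ideal generated by `x_{11}x_{12}`,
the products `x_{11}x_{ii}` for `2 ≤ i ≤ m`, and the products `x_{i,i−1}x_{jj}` for
`2 ≤ i ≤ m`, `i ≤ j ≤ m`. -/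
theorem alexanderDual_square_case (k : Type*) [Field k] (m : ℕ) (hm : 2 ≤ m) :
    (⨅ a ∈ {a : ℕ → ℕ | 1 ≤ a 1 ∧ a 1 ≤ a 2 ∧ (∀ i, 2 ≤ i → i < m → a i < a (i + 1)) ∧
        a m ≤ m},
      Ideal.span ((fun r => (X (ent m m (by omega) (by omega) r (a r)) :
        MvPolynomial (Fin m × Fin m) k)) '' Set.Icc 1 m)) =
    Ideal.span ({X (ent m m (by omega) (by omega) 1 1) * X (ent m m (by omega) (by omega) 1 2)} ∪
      {g : MvPolynomial (Fin m × Fin m) k | ∃ i, 2 ≤ i ∧ i ≤ m ∧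
        g = X (ent m m (by omega) (by omega) 1 1) * X (ent m m (by omega) (by omega) i i)} ∪
      {g : MvPolynomial (Fin m × Fin m) k | ∃ i j, 2 ≤ i ∧ i ≤ m ∧ i ≤ j ∧ j ≤ m ∧
        g = X (ent m m (by omega) (by omega) i (i - 1)) *
            X (ent m m (by omega) (by omega) j j)}) := by
  apply le_antisymm
  · intro f hf
    rw [← f.support_sum_monomial_coeff]
    refine Ideal.sum_mem _ fun d hd => ?_
    obtain ⟨h1, h2⟩ | ⟨i, hi2, him, h1, h2⟩ | ⟨i, j, hi2, him, hij, hjm, h1, h2⟩ :=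
      exists_pair_of_forall_sequence_meets hm
        (fun i j => d (ent m m (by omega) (by omega) i j) ≠ 0) (by
          intro a ha1 ha2 ha ham
          have hfa := (Submodule.mem_iInf _).1 ((Submodule.mem_iInf _).1 hf a) ⟨ha1, ha2, ha, ham⟩
          rw [← Set.image_image (fun p => (X p : MvPolynomial (Fin m × Fin m) k))
            (fun r => ent m m (by omega) (by omega) r (a r)), mem_ideal_span_X_image] at hfa
          obtain ⟨_, ⟨r, ⟨hr1, hrm⟩, rfl⟩, hr⟩ := hfa d hd
          exact ⟨r, hr1, hrm, hr⟩)
    · exact monomial_mem_of_X_mul_X_mem (ent_ne_ent (by omega) (by omega) (by omega) (by omega)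
        (by omega) (by omega) (by omega) (by omega) (by omega))
        (Ideal.subset_span (Or.inl (Or.inl rfl))) h1 h2 _
    · exact monomial_mem_of_X_mul_X_mem (ent_ne_ent (by omega) (by omega) (by omega) (by omega)
        (by omega) (by omega) (by omega) (by omega) (by omega))
        (Ideal.subset_span (Or.inl (Or.inr ⟨i, hi2, him, rfl⟩))) h1 h2 _
    · exact monomial_mem_of_X_mul_X_mem (ent_ne_ent (by omega) (by omega) (by omega) (by omega)
        (by omega) (by omega) (by omega) (by omega) (by omega))
        (Ideal.subset_span (Or.inr ⟨i, j, hi2, him, hij, hjm, rfl⟩)) h1 h2 _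
  · refine le_iInf₂ fun a ⟨ha1, ha2, ha, ham⟩ => Ideal.span_le.2 ?_
    have hX : ∀ r c, 1 ≤ r → r ≤ m → a r = c →
        (X (ent m m (by omega) (by omega) r c) : MvPolynomial (Fin m × Fin m) k) ∈
          Ideal.span ((fun r => (X (ent m m (by omega) (by omega) r (a r)) :
            MvPolynomial (Fin m × Fin m) k)) '' Set.Icc 1 m) := by
      rintro r _ hr1 hrm rfl
      exact Ideal.subset_span ⟨r, ⟨hr1, hrm⟩, rfl⟩
    have hlow : ∀ i, 2 ≤ i → i ≤ m → a 2 + (i - 2) ≤ a i := fun i hi him =>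
      add_sub_le_of_lt_succ ha le_rfl hi him
    have hupp : ∀ i, 2 ≤ i → i ≤ m → a i ≤ i := fun i hi him => by
      have := add_sub_le_of_lt_succ ha hi him le_rfl
      omega
    have h22 := hupp 2 le_rfl hm
    rintro g ((rfl | ⟨i, hi2, him, rfl⟩) | ⟨i, j, hi2, him, hij, hjm, rfl⟩)
    · by_cases h : a 1 = 1
      · exact Ideal.mul_mem_right _ _ (hX 1 1 le_rfl (by omega) h)
      · exact Ideal.mul_mem_left _ _ (hX 1 2 le_rfl (by omega) (by omega))
    · have hl := hlow i hi2 him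
      have hu := hupp i hi2 him
      by_cases h : a 1 = 1
      · exact Ideal.mul_mem_right _ _ (hX 1 1 le_rfl (by omega) h)
      · exact Ideal.mul_mem_left _ _ (hX i i (by omega) him (by omega))
    · have hl := hlow i hi2 him
      have hu := hupp j (by omega) hjm
      have hs := add_sub_le_of_lt_succ ha hi2 hij hjm
      by_cases h : a i = i - 1
      · exact Ideal.mul_mem_right _ _ (hX i (i - 1) (by omega) him h)
      · exact Ideal.mul_mem_left _ _ (hX j j (by omega) hjm (by omega))
end

section
/- Let R = k[x_{ij} : 1 ≤ i ≤ m, 1 ≤ j ≤ n] with k a field, 2 ≤ m ≤ n, and fix an integer 1 ≤ l ≤ m−1. Let I be the ideal generated by all monomials x_{1a_1}x_{2a_2}⋯x_{m a_m} with 1 ≤ a_1 < a_2 < ⋯ < a_l ≤ a_{l+1} < ⋯ < a_m ≤ n. Then the Stanley–Reisner ring R/I is Cohen–Macaulay; equivalently (by the Eagon–Reiner criterion), the Alexander dual I* has a linear minimal free resolution. -/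
open MvPolynomial Finset

open RingTheory.Sequence in
/-- The depth of a local ring: the supremum of lengths of regular sequences contained in the
maximal ideal. -/
noncomputable def localRingDepth (R : Type*) [CommRing R] [IsLocalRing R] : ℕ∞ :=
  sSup {d : ℕ∞ | ∃ rs : List R, (rs.length : ℕ∞) = d ∧
    (∀ r ∈ rs, r ∈ IsLocalRing.maximalIdeal R) ∧ RingTheory.Sequence.IsRegular R rs}

/-- A ring is Cohen–Macaulay if it is Noetherian and its localization at every prime ideal is a
Cohen–Macaulay local ring, i.e. depth equals Krull dimension. -/
def IsCohenMacaulayRing (R : Type*) [CommRing R] : Prop :=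
  IsNoetherianRing R ∧
    ∀ (P : Ideal R) [P.IsPrime],
      (localRingDepth (Localization.AtPrime P) : WithBot ℕ∞) =
        ringKrullDim (Localization.AtPrime P)

section CohenMacaulay

open RingTheory.Sequence

/-- A Noetherian ring is Cohen–Macaulay iff every localization at a prime `P` has a weakly
regular sequence of length at least the height of `P` in its maximal ideal. -/
theorem isCohenMacaulayRing_iff_exists_isWeaklyRegular {R : Type*} [CommRing R]
    [IsNoetherianRing R] :
    IsCohenMacaulayRing R ↔ ∀ (P : Ideal R) [P.IsPrime], ∃ rs : List (Localization.AtPrime P),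
      (∀ r ∈ rs, r ∈ IsLocalRing.maximalIdeal (Localization.AtPrime P)) ∧
      IsWeaklyRegular (Localization.AtPrime P) rs ∧ P.height ≤ rs.length := by
  have hdim (P : Ideal R) [P.IsPrime] : ringKrullDim (Localization.AtPrime P) = P.height :=
    IsLocalization.AtPrime.ringKrullDim_eq_height P _
  refine ⟨fun h P _ ↦ ?_, fun h ↦ ⟨inferInstance, fun P _ ↦ ?_⟩⟩
  · have hP : localRingDepth (Localization.AtPrime P) = P.height := by
      have := h.2 P
      rw [hdim P] at this
      exact_mod_cast this
    have hlt : localRingDepth (Localization.AtPrime P) < ⊤ := by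
      rw [hP]; exact Ideal.height_lt_top_of_isPrime
    have : Nonempty {d : ℕ∞ | ∃ rs : List (Localization.AtPrime P), (rs.length : ℕ∞) = d ∧
        (∀ r ∈ rs, r ∈ IsLocalRing.maximalIdeal (Localization.AtPrime P)) ∧
        IsRegular (Localization.AtPrime P) rs} :=
      ⟨0, [], by simp, by simp, IsRegular.nil _ _⟩
    obtain ⟨rs, hlen, hmem, hreg⟩ := ENat.sSup_mem_of_nonempty_of_lt_top hlt
    exact ⟨rs, hmem, hreg.toIsWeaklyRegular, by rw [hlen]; exact hP.ge⟩
  · obtain ⟨rs, hmem, hreg, hlen⟩ := h P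
    have hreg' := (IsLocalRing.isRegular_iff_isWeaklyRegular_of_subset_maximalIdeal hmem).2 hreg
    rw [hdim P, WithBot.coe_inj]
    refine le_antisymm (sSup_le ?_) (hlen.trans (le_sSup ⟨rs, rfl, hmem, hreg'⟩))
    rintro _ ⟨ss, rfl, -, hss⟩
    have h1 := ringKrullDim_add_length_eq_ringKrullDim_of_isRegular ss hss
    have : Nontrivial (Localization.AtPrime P ⧸ Ideal.ofList ss) := by
      refine Ideal.Quotient.nontrivial_iff.2 fun h ↦ hss.top_ne_smul ?_
      simp [h]
    have h2 : ((ss.length : ℕ∞) : WithBot ℕ∞) ≤ P.height := by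
      rw [← hdim P, ← h1]
      calc ((ss.length : ℕ∞) : WithBot ℕ∞) = 0 + (ss.length : WithBot ℕ∞) := by simp
        _ ≤ _ := by gcongr; exact ringKrullDim_nonneg_of_nontrivial
    exact_mod_cast h2

/-- A flat integral algebra over a Cohen–Macaulay ring is Cohen–Macaulay if it is Noetherian. -/
theorem IsCohenMacaulayRing.of_flat_of_isIntegral {A B : Type*} [CommRing A] [CommRing B]
    [Algebra A B] [Module.Flat A B] [Algebra.IsIntegral A B] [IsNoetherianRing B]
    (hA : IsCohenMacaulayRing A) : IsCohenMacaulayRing B := by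
  have := hA.1
  rw [isCohenMacaulayRing_iff_exists_isWeaklyRegular] at hA ⊢
  intro P _
  obtain ⟨rs, hmem, hreg, hlen⟩ := hA (P.under A)
  let := Localization.AtPrime.algebraOfLiesOver (P.under A) P
  have hloc : IsLocalHom
      (algebraMap (Localization.AtPrime <| P.under A) (Localization.AtPrime P)) := by
    rw [RingHom.algebraMap_toAlgebra]
    exact Localization.isLocalHom_localRingHom (P.under A) P (algebraMap A B) Ideal.LiesOver.over
  refine ⟨rs.map (algebraMap _ _), ?_, hreg.of_flat, ?_⟩
  · intro r hr
    obtain ⟨x, hx, rfl⟩ := List.mem_map.1 hr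
    rw [IsLocalRing.mem_maximalIdeal, map_mem_nonunits_iff]
    exact hmem x hx
  · rw [List.length_map]
    refine le_trans ?_ hlen
    have hmono : StrictMono (PrimeSpectrum.comap (algebraMap A B)) := fun p q hpq ↦
      Ideal.IsIntegral.comap_lt_comap (R := A) (I := p.asIdeal) (J := q.asIdeal) hpq
    have := Order.height_le_height_apply_of_strictMono _ hmono ⟨P, ‹_›⟩
    rwa [← PrimeSpectrum.height_eq_orderHeight, ← PrimeSpectrum.height_eq_orderHeight] at this

theorem IsCohenMacaulayRing.of_ringEquiv {A B : Type*} [CommRing A] [CommRing B] (e : A ≃+* B)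
    (hA : IsCohenMacaulayRing A) : IsCohenMacaulayRing B := by
  let := e.toRingHom.toAlgebra
  have := hA.1
  have := isNoetherianRing_of_ringEquiv A e
  let f : A ≃ₗ[A] B :=
    { e with map_smul' := fun a b ↦ by simp [Algebra.smul_def, RingHom.algebraMap_toAlgebra] }
  have : Module.Flat A B := Module.Flat.of_linearEquiv f.symm
  have : Module.Finite A B := Module.Finite.equiv f
  exact hA.of_flat_of_isIntegral

theorem IsCohenMacaulayRing.of_field (k : Type*) [Field k] : IsCohenMacaulayRing k := by
  rw [isCohenMacaulayRing_iff_exists_isWeaklyRegular]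
  intro P _
  refine ⟨[], by simp, by simp, ?_⟩
  have : P = ⊥ := (Ideal.eq_bot_or_top P).resolve_right (Ideal.IsPrime.ne_top ‹_›)
  subst this
  simp

namespace Polynomial

/-- A monic polynomial is a nonzerodivisor modulo any ideal extended from the coefficients. -/
theorem Monic.isSMulRegular_quotient_map_C {R : Type*} [CommRing R] {f : R[X]} (hf : f.Monic)
    (I : Ideal R) : IsSMulRegular (R[X] ⧸ I.map C) f := by
  rw [isSMulRegular_iff_right_eq_zero_of_smul]
  intro x hx
  obtain ⟨g, rfl⟩ := Ideal.Quotient.mk_surjective x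
  have key (p : R[X]) : p ∈ I.map C ↔ p.map (Ideal.Quotient.mk I) = 0 := by
    rw [← coe_mapRingHom, ← RingHom.mem_ker, ker_mapRingHom, Ideal.mk_ker]
  change Ideal.Quotient.mk _ (f * g) = 0 at hx
  rw [Ideal.Quotient.eq_zero_iff_mem, key, Polynomial.map_mul] at hx
  rw [Ideal.Quotient.eq_zero_iff_mem, key]
  exact (hf.map _).mul_right_eq_zero_iff.1 hx

/-- Let `P` be a prime of `R[X]` over the maximal ideal of a local ring `R`. A weakly regular
sequence in `R` of length at least `dim R` can be prolonged to one in `P` of length at least the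
height of `P`. -/
theorem exists_isWeaklyRegular_of_comap_C_eq_maximalIdeal {R : Type*} [CommRing R] [IsLocalRing R]
    [IsNoetherianRing R] {rs : List R} (hmem : ∀ r ∈ rs, r ∈ IsLocalRing.maximalIdeal R)
    (hreg : IsWeaklyRegular R rs) (hlen : (IsLocalRing.maximalIdeal R).height ≤ rs.length)
    (P : Ideal R[X]) [P.IsPrime] (hP : P.comap C = IsLocalRing.maximalIdeal R) :
    ∃ ss : List R[X], (∀ s ∈ ss, s ∈ P) ∧ IsWeaklyRegular R[X] ss ∧ P.height ≤ ss.length := by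
  have hreg' : IsWeaklyRegular R[X] (rs.map C) := hreg.of_flat (S := R[X])
  have hmem' : ∀ s ∈ rs.map C, s ∈ P := by
    intro s hs
    obtain ⟨r, hr, rfl⟩ := List.mem_map.1 hs
    rw [← Ideal.mem_comap, hP]
    exact hmem r hr
  by_cases heq : P = (P.comap C).map C
  · refine ⟨rs.map C, hmem', hreg', ?_⟩
    rw [heq, hP, height_map_C, List.length_map]
    exact hlen
  · have hmax : (P.comap C).IsMaximal := hP ▸ IsLocalRing.maximalIdeal.isMaximal R
    obtain ⟨f, hf, hPf⟩ := exists_monic_span_sup_map_eq R P hmax heq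
    refine ⟨rs.map C ++ [f], ?_, ?_, ?_⟩
    · intro s hs
      rcases List.mem_append.1 hs with hs | hs
      · exact hmem' s hs
      · rw [List.mem_singleton.1 hs, hPf]
        exact Ideal.mem_sup_right (Ideal.mem_span_singleton_self f)
    · rw [isWeaklyRegular_append_iff]
      refine ⟨hreg', (isWeaklyRegular_singleton_iff _ _).2 ?_⟩
      rw [smul_eq_mul, Ideal.mul_top, ← Ideal.map_ofList]
      exact hf.isSMulRegular_quotient_map_C _
    · have : P.LiesOver (IsLocalRing.maximalIdeal R) := ⟨hP.symm⟩
      refine (Ideal.height_le_height_add_of_liesOver (IsLocalRing.maximalIdeal R) P).trans ?_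
      rw [List.length_append, List.length_map, List.length_singleton, Nat.cast_add, Nat.cast_one]
      refine add_le_add hlen ?_
      have h1 : P.map (Ideal.Quotient.mk ((IsLocalRing.maximalIdeal R).map (algebraMap R R[X]))) =
          Ideal.span {Ideal.Quotient.mk _ f} := by
        conv_lhs => rw [hPf]
        rw [hP, Ideal.map_sup, Ideal.map_span, Set.image_singleton, ← algebraMap_eq,
          Ideal.map_quotient_self, bot_sup_eq]
      rw [h1]
      refine Ideal.height_span_singleton_le_one fun hu ↦ ?_
      rw [← Ideal.span_singleton_eq_top, ← h1] at hu
      have hle : (IsLocalRing.maximalIdeal R).map (algebraMap R R[X]) ≤ P := by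
        rw [Ideal.map_le_iff_le_comap, algebraMap_eq, hP]
      have := Ideal.comap_map_of_surjective' _ (Ideal.Quotient.mk_surjective
        (I := (IsLocalRing.maximalIdeal R).map (algebraMap R R[X]))) P
      rw [hu, Ideal.comap_top, Ideal.mk_ker, sup_eq_left.2 hle] at this
      exact Ideal.IsPrime.ne_top ‹P.IsPrime› this.symm

end Polynomial

open scoped Polynomial in
theorem IsCohenMacaulayRing.polynomial {R : Type*} [CommRing R] (hR : IsCohenMacaulayRing R) :
    IsCohenMacaulayRing R[X] := by
  have := hR.1
  rw [isCohenMacaulayRing_iff_exists_isWeaklyRegular] at hR ⊢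
  intro p hp
  let q := p.comap Polynomial.C
  obtain ⟨rs, hmem, hreg, hlen⟩ := hR q
  let S := (Localization.AtPrime q)[X]
  let pc := Submonoid.map Polynomial.C.toMonoidHom q.primeCompl
  let : Algebra R[X] S := Polynomial.algebra R (Localization.AtPrime q)
  have : IsLocalization pc S := Polynomial.isLocalization _ _
  let pS := p.map (algebraMap R[X] S)
  have disj : Disjoint (pc : Set R[X]) (p : Set R[X]) := by
    simpa [pc, q] using! Set.disjoint_image_left.mpr
      (Set.disjoint_compl_left_iff_subset.mpr (fun _ a ↦ a))
  have : pS.IsPrime := IsLocalization.isPrime_of_isPrime_disjoint pc _ _ ‹_› disj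
  have hunder : pS.under R[X] = p := IsLocalization.under_map_of_isPrime_disjoint pc _ ‹_› disj
  have : IsLocalization.AtPrime (Localization.AtPrime pS) p := by
    convert IsLocalization.isLocalization_isLocalization_atPrime_isLocalization pc
      (Localization.AtPrime pS) pS
    exact hunder.symm
  have eq : Ideal.comap Polynomial.C pS = IsLocalRing.maximalIdeal (Localization.AtPrime q) := by
    rw [← IsLocalization.map_under q.primeCompl _ (Ideal.comap Polynomial.C pS),
      ← IsLocalization.map_under q.primeCompl _ (IsLocalRing.maximalIdeal (Localization.AtPrime q))]
    simp only [Ideal.comap_comap, S, pS]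
    rw [← Polynomial.algebraMap_eq (R := Localization.AtPrime q),
      ← IsScalarTower.algebraMap_eq R (Localization.AtPrime q) (Localization.AtPrime q)[X],
      IsScalarTower.algebraMap_eq R R[X] (Localization.AtPrime q)[X], ← Ideal.comap_comap,
      ← Ideal.under_def R[X], IsLocalization.under_map_of_isPrime_disjoint pc _ ‹_› disj]
    simp [q, IsLocalization.AtPrime.under_maximalIdeal (Localization.AtPrime q) q]
  have hq : (IsLocalRing.maximalIdeal (Localization.AtPrime q)).height ≤ rs.length := by
    rwa [← IsLocalization.height_under q.primeCompl, IsLocalization.AtPrime.under_maximalIdeal _ q]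
  obtain ⟨ss, hss, hsreg, hslen⟩ :=
    Polynomial.exists_isWeaklyRegular_of_comap_C_eq_maximalIdeal hmem hreg hq pS eq
  let e : Localization.AtPrime pS ≃+* Localization.AtPrime p :=
    (IsLocalization.algEquiv p.primeCompl (Localization.AtPrime pS)
      (Localization.AtPrime p)).toRingEquiv
  have htreg := hsreg.of_isLocalization (Localization.AtPrime pS) pS.primeCompl
  refine ⟨(ss.map (algebraMap S (Localization.AtPrime pS))).map e, ?_, ?_, ?_⟩
  · intro r hr
    simp only [List.map_map, List.mem_map, Function.comp_apply] at hr
    obtain ⟨s, hs, rfl⟩ := hr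
    have : algebraMap S (Localization.AtPrime pS) s ∈
        IsLocalRing.maximalIdeal (Localization.AtPrime pS) :=
      (IsLocalization.AtPrime.to_map_mem_maximal_iff _ pS s).2 (hss s hs)
    rw [IsLocalRing.mem_maximalIdeal, mem_nonunits_iff] at this ⊢
    simpa using this
  · refine (AddEquiv.isWeaklyRegular_congr (e := e.toAddEquiv) ?_).1 htreg
    exact List.forall₂_map_right_iff.2 (List.forall₂_same.2 fun r _ x ↦ by simp)
  · simp only [List.length_map]
    rwa [← hunder, IsLocalization.height_under pc]

theorem IsCohenMacaulayRing.mvPolynomial {R : Type*} [CommRing R] (hR : IsCohenMacaulayRing R)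
    (ι : Type*) [Finite ι] : IsCohenMacaulayRing (MvPolynomial ι R) := by
  induction ι using Finite.induction_empty_option with
  | of_equiv e ih => exact ih.of_ringEquiv (renameEquiv _ e).toRingEquiv
  | h_empty => exact hR.of_ringEquiv (isEmptyRingEquiv R _).symm
  | h_option ih => exact ih.polynomial.of_ringEquiv (optionEquivLeft R _).symm.toRingEquiv

end CohenMacaulay

/-- A family that is triangular with respect to a family of functionals, with nonzero diagonal
entries, is linearly independent. -/
theorem linearIndependent_of_triangular {ι A M : Type*} [Finite ι] [PartialOrder ι] [CommRing A]
    [IsDomain A] [AddCommGroup M] [Module A M] (f : ι → M) (φ : ι → M →ₗ[A] A)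
    (hle : ∀ c d, φ c (f d) ≠ 0 → c ≤ d) (hne : ∀ c, φ c (f c) ≠ 0) : LinearIndependent A f := by
  classical
  have := Fintype.ofFinite ι
  rw [Fintype.linearIndependent_iff]
  intro g hg
  by_contra! h
  obtain ⟨i, hi⟩ := h
  obtain ⟨c, hc⟩ := (Set.toFinite {i | g i ≠ 0}).exists_maximal ⟨i, hi⟩
  have h0 := congrArg (φ c) hg
  rw [map_sum, map_zero, Finset.sum_eq_single c] at h0
  · rw [map_smul, smul_eq_mul] at h0
    exact mul_ne_zero hc.1 (hne c) h0
  · intro d _ hd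
    rw [map_smul, smul_eq_mul]
    by_contra h
    have hcd := hle c d (right_ne_zero_of_mul h)
    exact hd (le_antisymm (hc.2 (left_ne_zero_of_mul h) hcd) hcd)
  · simp

/-- A product of translates `z j + s j` agrees with the monomial `∏ z j` up to a combination of
products of fewer factors. -/
theorem prod_add_algebraMap_sub_prod_mem {A B κ : Type*} [CommRing A] [CommRing B] [Algebra A B]
    (z : ℕ → B) (b : κ → ℕ) (s : κ → A) (T : Finset κ) (M : Submodule A B)
    (hM : ∀ S ⊂ T, ∏ j ∈ S, z (b j) ∈ M) :
    ∏ j ∈ T, (z (b j) + algebraMap A B (s j)) - ∏ j ∈ T, z (b j) ∈ M := by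
  classical
  rw [Finset.prod_add, ← Finset.add_sum_erase _ _ (Finset.mem_powerset_self T)]
  simp only [Finset.sdiff_self, Finset.prod_empty, mul_one, add_sub_cancel_left]
  refine M.sum_mem fun S hS ↦ ?_
  obtain ⟨hne, hS⟩ := Finset.mem_erase.1 hS
  rw [← map_prod, mul_comm, ← Algebra.smul_def]
  exact M.smul_mem _ (hM S ((Finset.mem_powerset.1 hS).ssubset_of_ne hne))

/-- A monotone map without fixed points on an initial segment lies above the diagonal there. -/
theorem lt_of_monotone_of_ne {f : ℕ → ℕ} {r : ℕ} (hf : ∀ i, i + 1 < r → f i ≤ f (i + 1))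
    (hne : ∀ i < r, f i ≠ i) : ∀ i < r, i < f i := by
  intro i
  induction i with
  | zero => intro h; exact Nat.pos_of_ne_zero (hne 0 h)
  | succ i ih =>
    intro h
    have := ih (by omega)
    have := hf i h
    have := hne (i + 1) h
    omega

section Letterplace

variable {A B : Type*} [CommRing A] [CommRing B] [Algebra A B]

/-- The product of the factors `z b + s j b` along a monotone sequence `c` of length at most `r`,
where the value `N` stands for a missing entry. -/
noncomputable def translateProd (z : ℕ → B) (s : ℕ → ℕ → A) {r N : ℕ}
    (c : Fin r →o Fin (N + 1)) : B :=
  ∏ j : Fin r, if (c j : ℕ) < N then z (c j) + algebraMap A B (s j (c j)) else 1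

/-- Every multiset of numbers below `N` is enumerated by a monotone sequence that is constantly `N`
afterwards. -/
theorem exists_monotone_of_multiset {N : ℕ} (w : Multiset ℕ) (hw : ∀ b ∈ w, b < N) :
    ∃ a : ℕ → ℕ, Monotone a ∧ (∀ j, a j ≤ N) ∧ (∀ j < w.card, a j < N) ∧
      (∀ j, w.card ≤ j → a j = N) ∧ w = (Multiset.range w.card).map a := by
  have hlen : (w.sort (· ≤ ·)).length = w.card := Multiset.length_sort _
  have hmem : ∀ j (h : j < (w.sort (· ≤ ·)).length), (w.sort (· ≤ ·))[j] < N := fun j h ↦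
    hw _ ((Multiset.mem_sort (r := (· ≤ ·))).1 (List.getElem_mem h))
  have hle : ∀ j, (w.sort (· ≤ ·)).getD j N ≤ N := by
    intro j
    by_cases h : j < (w.sort (· ≤ ·)).length
    · rw [List.getD_eq_getElem _ _ h]; exact (hmem j h).le
    · rw [List.getD_eq_default _ _ (not_lt.1 h)]
  refine ⟨fun j ↦ (w.sort (· ≤ ·)).getD j N, fun i j hij ↦ ?_, hle, fun j hj ↦ ?_,
    fun j hj ↦ ?_, ?_⟩
  · by_cases h : j < (w.sort (· ≤ ·)).length
    · simp only [List.getD_eq_getElem _ _ h, List.getD_eq_getElem _ _ (hij.trans_lt h)]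
      rcases hij.eq_or_lt with rfl | hij
      · exact le_rfl
      · exact List.pairwise_iff_getElem.1 (Multiset.pairwise_sort w (· ≤ ·)) _ _ _ _ hij
    · simp only [List.getD_eq_default _ _ (not_lt.1 h)]
      exact hle i
  · rw [← hlen] at hj
    simp only [List.getD_eq_getElem _ _ hj]
    exact hmem j hj
  · exact List.getD_eq_default _ _ (hlen.trans_le hj)
  · conv_lhs => rw [← Multiset.sort_eq w (· ≤ ·)]
    rw [← hlen]
    change _ = ((List.range _ : List ℕ) : Multiset ℕ).map _
    rw [Multiset.map_coe]
    congr 1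
    refine List.ext_getElem (by simp) fun i h1 h2 ↦ ?_
    rw [List.getElem_map, List.getElem_range, List.getD_eq_getElem _ _ h1]

/-- If `B` is generated over `A` by the `z b`, and the products of `r + 1` translates along
monotone sequences vanish, then the products of at most `r` translates span `B`. -/
theorem span_translateProd_eq_top (z : ℕ → B) (s : ℕ → ℕ → A) (r N : ℕ)
    (hgen : Algebra.adjoin A (z '' {b | b < N}) = ⊤)
    (hzero : ∀ a : ℕ → ℕ, Monotone a → (∀ j < r + 1, a j < N) →
      ∏ j ∈ Finset.range (r + 1), (z (a j) + algebraMap A B (s j (a j))) = 0) :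
    Submodule.span A (Set.range (translateProd z s : (Fin r →o Fin (N + 1)) → B)) = ⊤ := by
  set M := Submodule.span A (Set.range (translateProd z s : (Fin r →o Fin (N + 1)) → B))
  have key : ∀ (t : ℕ) (w : Multiset ℕ), w.card = t → (∀ b ∈ w, b < N) → (w.map z).prod ∈ M := by
    intro t
    induction t using Nat.strong_induction_on with
    | _ t ih =>
    intro w hwt hw
    obtain ⟨a, ha, haN, halt, hage, hwa⟩ := exists_monotone_of_multiset w hw
    rw [hwt] at halt hage hwa
    have hprod : (w.map z).prod = ∏ j ∈ Finset.range t, z (a j) := by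
      rw [hwa, Multiset.map_map]; rfl
    have hsub : ∏ j ∈ Finset.range t, (z (a j) + algebraMap A B (s j (a j))) -
        ∏ j ∈ Finset.range t, z (a j) ∈ M := by
      refine prod_add_algebraMap_sub_prod_mem z a _ _ M fun S hS ↦ ?_
      have h1 : S.card < t := by simpa using Finset.card_lt_card hS
      have h2 := ih S.card h1 (S.val.map a) (by simp) (by
        intro b hb
        obtain ⟨j, hj, rfl⟩ := Multiset.mem_map.1 hb
        exact halt j (Finset.mem_range.1 (hS.1 hj)))
      rw [Multiset.map_map] at h2
      exact h2
    have hF : ∏ j ∈ Finset.range t, (z (a j) + algebraMap A B (s j (a j))) ∈ M := by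
      by_cases htr : t ≤ r
      · refine Submodule.subset_span ⟨⟨fun j ↦ ⟨a j, Nat.lt_succ_of_le (haN j)⟩, fun i j hij ↦
          ha (show (i : ℕ) ≤ j from hij)⟩, ?_⟩
        refine (Fin.prod_univ_eq_prod_range
          (fun j ↦ if a j < N then z (a j) + algebraMap A B (s j (a j)) else 1) r).trans ?_
        rw [← Finset.prod_subset (Finset.range_mono htr)]
        · refine Finset.prod_congr rfl fun j hj ↦ ?_
          rw [if_pos (halt j (Finset.mem_range.1 hj))]
        · intro j _ hj
          rw [if_neg]
          rw [Finset.mem_range, not_lt] at hj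
          simp [hage j hj]
      · have htr' : r + 1 ≤ t := by omega
        rw [← Finset.prod_range_mul_prod_Ico _ htr', hzero a ha fun j hj ↦ halt j (by omega),
          zero_mul]
        exact M.zero_mem
    rw [hprod]
    have := M.sub_mem hF hsub
    rwa [sub_sub_cancel] at this
  rw [eq_top_iff, ← Algebra.top_toSubmodule, ← hgen, Algebra.adjoin_eq_span, Submodule.span_le]
  have hcl : ∀ x ∈ Submonoid.closure (z '' {b | b < N}),
      ∃ w : Multiset ℕ, (∀ b ∈ w, b < N) ∧ (w.map z).prod = x := by
    intro x hx
    induction hx using Submonoid.closure_induction with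
    | mem x hx =>
      obtain ⟨b, hb, rfl⟩ := hx
      exact ⟨{b}, by simpa using hb, by simp⟩
    | one => exact ⟨0, by simp, by simp⟩
    | mul x y _ _ hx hy =>
      obtain ⟨w, hw, rfl⟩ := hx
      obtain ⟨w', hw', rfl⟩ := hy
      refine ⟨w + w', fun b hb ↦ ?_, by simp⟩
      exact (Multiset.mem_add.1 hb).elim (hw b) (hw' b)
  intro x hx
  obtain ⟨w, hw, rfl⟩ := hcl x hx
  exact key _ w rfl hw

/-- The number of entries of `c` that are at most `b`. -/
def countLE {r N : ℕ} (c : Fin r →o Fin (N + 1)) (b : ℕ) : ℕ :=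
  (Finset.univ.filter fun i ↦ (c i : ℕ) ≤ b).card

theorem countLE_mono {r N : ℕ} (c : Fin r →o Fin (N + 1)) : Monotone (countLE c) := by
  intro b b' h
  refine Finset.card_le_card fun i hi ↦ ?_
  simp only [Finset.mem_filter, Finset.mem_univ, true_and] at hi ⊢
  exact hi.trans h

theorem countLE_le {r N : ℕ} (c : Fin r →o Fin (N + 1)) (b : ℕ) : countLE c b ≤ r :=
  (Finset.card_le_univ _).trans (by simp)

theorem lt_countLE_iff {r N : ℕ} (c : Fin r →o Fin (N + 1)) (j : Fin r) (b : ℕ) :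
    (j : ℕ) < countLE c b ↔ (c j : ℕ) ≤ b := by
  constructor
  · intro h
    by_contra! hb
    refine h.not_ge ?_
    calc countLE c b ≤ (Finset.Iio j).card := by
          refine Finset.card_le_card fun i hi ↦ ?_
          simp only [Finset.mem_filter, Finset.mem_univ, true_and, Finset.mem_Iio] at hi ⊢
          by_contra! hij
          have : (c j : ℕ) ≤ c i := c.monotone hij
          omega
      _ = j := by simp
  · intro h
    calc (j : ℕ) < (Finset.Iic j).card := by simp
      _ ≤ countLE c b := by
          refine Finset.card_le_card fun i hi ↦ ?_
          simp only [Finset.mem_filter, Finset.mem_univ, true_and, Finset.mem_Iic] at hi ⊢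
          exact (show (c i : ℕ) ≤ c j from c.monotone hi).trans h

/-- A quotient of `A[z₀, …, z_{N-1}]` by the products of `r + 1` generic translates of the
variables along monotone sequences is finite free. -/
theorem free_and_finite_of_translates [IsDomain A] (z : ℕ → B) (s : ℕ → ℕ → A) (r N : ℕ)
    (hgen : Algebra.adjoin A (z '' {b | b < N}) = ⊤)
    (hzero : ∀ a : ℕ → ℕ, Monotone a → (∀ j < r + 1, a j < N) →
      ∏ j ∈ Finset.range (r + 1), (z (a j) + algebraMap A B (s j (a j))) = 0)
    (hs : ∀ b < N, ∀ i ≤ r, ∀ j ≤ r, s i b = s j b → i = j)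
    (hev : ∀ p : ℕ → ℕ, Monotone p → (∀ b, p b ≤ r) →
      ∃ φ : B →ₐ[A] A, ∀ b < N, φ (z b) = - s (p b) b) :
    Module.Free A B ∧ Module.Finite A B := by
  have : Finite (Fin r →o Fin (N + 1)) := Finite.of_injective _ DFunLike.coe_injective
  choose φ hφ using fun c : Fin r →o Fin (N + 1) ↦ hev (countLE c) (countLE_mono c) (countLE_le c)
  have hval (c d : Fin r →o Fin (N + 1)) : φ c (translateProd z s d) ≠ 0 ↔
      ∀ j : Fin r, (d j : ℕ) < N → countLE c (d j) ≠ j := by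
    rw [translateProd, map_prod, Finset.prod_ne_zero_iff]
    refine forall_congr' fun j ↦ ?_
    by_cases hj : (d j : ℕ) < N
    · simp only [Finset.mem_univ, hj, if_true, forall_true_left, map_add, hφ c _ hj,
        AlgHom.commutes, Algebra.algebraMap_self, RingHom.id_apply]
      rw [neg_add_eq_sub, sub_ne_zero, not_iff_not]
      exact ⟨fun h ↦ (hs _ hj _ j.2.le _ (countLE_le _ _) h).symm, fun h ↦ by rw [h]⟩
    · simp [hj]
  have hli : LinearIndependent A (translateProd z s : (Fin r →o Fin (N + 1)) → B) := by
    refine linearIndependent_of_triangular _ (fun c ↦ (φ c).toLinearMap) (fun c d h ↦ ?_)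
      fun c ↦ ?_
    · have h := (hval c d).1 h
      have hlt : ∀ i, ∀ hi : i < r, (d ⟨i, hi⟩ : ℕ) < N → i < countLE c (d ⟨i, hi⟩) := by
        intro i
        induction i with
        | zero => intro hi hd; exact Nat.pos_of_ne_zero (h ⟨0, hi⟩ hd)
        | succ i ih =>
          intro hi hd
          have hle : (d ⟨i, by omega⟩ : ℕ) ≤ d ⟨i + 1, hi⟩ :=
            d.monotone (Fin.mk_le_mk.2 (Nat.le_succ i))
          have h1 := ih (by omega) (hle.trans_lt hd)
          have h2 := countLE_mono c hle
          have h3 := h ⟨i + 1, hi⟩ hd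
          simp only at h3
          omega
      intro j
      by_cases hj : (d j : ℕ) < N
      · exact (lt_countLE_iff c j _).1 (hlt j j.2 hj)
      · exact Fin.le_def.2 ((Nat.lt_succ_iff.1 (c j).2).trans (not_lt.1 hj))
    · exact (hval c c).2 fun j _ ↦ ((lt_countLE_iff c j _).2 le_rfl).ne'
  let bas := Module.Basis.mk hli (span_translateProd_eq_top z s r N hgen hzero).ge
  exact ⟨Module.Free.of_basis bas, Module.Finite.of_basis bas⟩

end Letterplace

/-- A quotient of a polynomial ring by the ideal of the products `∏ j, X (V j (a j))` along
monotone sequences `a : {0, …, r} → {0, …, N - 1}`, for pairwise distinct variables `X (V j b)`,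
is Cohen–Macaulay. -/
theorem isCohenMacaulayRing_of_ker_eq_span_monotone {k B : Type*} [Field k] [CommRing B]
    {σ : Type*} [Finite σ] (V : ℕ → ℕ → σ) (r N : ℕ)
    (hV : ∀ i ≤ r, ∀ b < N, ∀ i' ≤ r, ∀ b' < N, V i b = V i' b' → i = i' ∧ b = b')
    (π : MvPolynomial σ k →+* B) (hπ : Function.Surjective π)
    (hker : RingHom.ker π = Ideal.span {g : MvPolynomial σ k | ∃ a : ℕ → ℕ,
      Monotone a ∧ (∀ j < r + 1, a j < N) ∧ g = ∏ j ∈ Finset.range (r + 1), X (V j (a j))}) :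
    IsCohenMacaulayRing B := by
  classical
  obtain ⟨col, hcol, hcol'⟩ : ∃ col : σ → ℕ, (∀ i ≤ r, ∀ b < N, col (V i b) = b) ∧
      ∀ t, col t < N → ∃ i ≤ r, t = V i (col t) := by
    have h (t : σ) : ∃ b, (∀ i' ≤ r, ∀ b' < N, V i' b' = t → b = b') ∧
        (b < N → ∃ i ≤ r, t = V i b) := by
      by_cases ht : ∃ b < N, ∃ i ≤ r, t = V i b
      · obtain ⟨b, hb, i, hi, rfl⟩ := ht
        exact ⟨b, fun i' hi' b' hb' h ↦ (hV _ hi' _ hb' _ hi _ hb h).2.symm, fun _ ↦ ⟨i, hi, rfl⟩⟩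
      · exact ⟨N, fun i' hi' b' hb' h ↦ (ht ⟨b', hb', i', hi', h.symm⟩).elim,
          fun h ↦ (lt_irrefl _ h).elim⟩
    choose col h1 h2 using h
    exact ⟨col, fun i hi b hb ↦ h1 _ i hi b hb rfl, h2⟩
  let base (t : σ) : Prop := col t < N ∧ t = V 0 (col t)
  let τ := {t : σ // ¬ base t}
  let S (t : σ) : MvPolynomial τ k := if h : ¬ base t then X ⟨t, h⟩ else 0
  let Z (t : σ) : MvPolynomial σ k := if col t < N then X (V 0 (col t)) else 0
  let ψ : MvPolynomial τ k →ₐ[k] MvPolynomial σ k := aeval fun t ↦ X t.1 - Z t.1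
  have hψX (t : τ) : ψ (X t) = X t.1 - Z t.1 := aeval_X _ _
  let : Algebra (MvPolynomial τ k) B := (π.comp ψ.toRingHom).toAlgebra
  have halg (x : MvPolynomial τ k) : algebraMap (MvPolynomial τ k) B x = π (ψ x) := rfl
  let z (b : ℕ) : B := π (X (V 0 b))
  let s (i b : ℕ) : MvPolynomial τ k := S (V i b)
  have hS0 (b : ℕ) (hb : b < N) : S (V 0 b) = 0 := by
    have : base (V 0 b) := by simp only [base, hcol 0 (Nat.zero_le r) b hb]; exact ⟨hb, trivial⟩
    simp [S, this]
  have hbase (i : ℕ) (hi : i ≤ r) (b : ℕ) (hb : b < N) (h : base (V i b)) : i = 0 := by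
    simp only [base, hcol i hi b hb] at h
    exact (hV i hi b hb 0 (Nat.zero_le r) b hb h.2).1
  have hzs (i : ℕ) (hi : i ≤ r) (b : ℕ) (hb : b < N) :
      z b + algebraMap (MvPolynomial τ k) _ (s i b) = π (X (V i b)) := by
    by_cases h : base (V i b)
    · obtain rfl := hbase i hi b hb h
      simp [s, hS0 b hb, z]
    · simp [s, S, h, halg, hψX, Z, hcol i hi b hb, hb, z]
  have hfree : Module.Free (MvPolynomial τ k) B ∧ Module.Finite (MvPolynomial τ k) B := by
    refine free_and_finite_of_translates z s r N ?_ ?_ ?_ ?_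
    · rw [eq_top_iff]
      rintro x -
      obtain ⟨x, rfl⟩ := hπ x
      induction x using MvPolynomial.induction_on with
      | C c =>
        have : π (C c) = algebraMap (MvPolynomial τ k) _ (C c) := by simp [halg, ψ]
        rw [this]
        exact Subalgebra.algebraMap_mem _ _
      | add p q hp hq => rw [map_add]; exact add_mem hp hq
      | mul_X p t hp =>
        rw [map_mul]
        refine mul_mem hp ?_
        have hz (b : ℕ) (hb : b < N) : z b ∈ Algebra.adjoin (MvPolynomial τ k) (z '' {b | b < N}) :=
          Algebra.subset_adjoin ⟨b, hb, rfl⟩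
        by_cases h : col t < N
        · obtain ⟨i, hi, ht⟩ := hcol' t h
          rw [ht, ← hzs i hi _ h]
          exact add_mem (hz _ h) (Subalgebra.algebraMap_mem _ _)
        · have : π (X t) = algebraMap (MvPolynomial τ k) _ (X ⟨t, fun hb ↦ h hb.1⟩) := by
            simp [halg, hψX, Z, h]
          rw [this]
          exact Subalgebra.algebraMap_mem _ _
    · intro a ha haN
      rw [Finset.prod_congr rfl fun j hj ↦ hzs j (Nat.lt_succ_iff.1 (Finset.mem_range.1 hj)) _
        (haN j (Finset.mem_range.1 hj)), ← map_prod, ← RingHom.mem_ker, hker]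
      exact Ideal.subset_span ⟨a, ha, haN, rfl⟩
    · intro b hb i hi j hj h
      by_cases hbi : base (V i b) <;> by_cases hbj : base (V j b)
      · rw [hbase i hi b hb hbi, hbase j hj b hb hbj]
      · simp [s, S, hbi, hbj, (X_ne_zero _).symm] at h
      · simp [s, S, hbi, hbj] at h
      · simp only [s, S, hbi, hbj, not_false_eq_true, dite_true] at h
        exact (hV i hi b hb j hj b hb (Subtype.ext_iff.1 (X_injective h))).1
    · intro p hp hpr
      let E (t : σ) : MvPolynomial τ k := if col t < N then - S (V (p (col t)) (col t)) else 0
      let ev : MvPolynomial σ k →ₐ[k] MvPolynomial τ k := aeval fun t ↦ S t + E t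
      have hev (i : ℕ) (hi : i ≤ r) (b : ℕ) (hb : b < N) :
          ev (X (V i b)) = S (V i b) - S (V (p b) b) := by
        simp [ev, E, hcol i hi b hb, hb, sub_eq_add_neg]
      have hle : RingHom.ker π ≤ RingHom.ker ev.toRingHom := by
        rw [hker, Ideal.span_le]
        rintro _ ⟨a, ha, haN, rfl⟩
        obtain ⟨i, hi, hpi⟩ : ∃ i < r + 1, p (a i) = i := by
          by_contra! h
          exact (lt_of_monotone_of_ne (f := p ∘ a) (fun i _ ↦ hp (ha (Nat.le_succ i))) h r
            (Nat.lt_succ_self r)).not_ge (hpr _)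
        change ev _ = 0
        rw [map_prod]
        refine Finset.prod_eq_zero (Finset.mem_range.2 hi) ?_
        rw [hev i (Nat.lt_succ_iff.1 hi) _ (haN i hi), hpi, sub_self]
      have hψ : ev.comp ψ = AlgHom.id k (MvPolynomial τ k) := by
        refine MvPolynomial.algHom_ext fun t ↦ ?_
        have hSt : S t.1 = X t := by simp [S, t.2]
        by_cases h : col t.1 < N
        · simp only [AlgHom.comp_apply, hψX, map_sub, Z, h, if_true, AlgHom.id_apply,
            hev 0 (Nat.zero_le r) _ h, hS0 _ h]
          simp [ev, E, h, hSt]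
        · simp [hψX, Z, h, ev, E, hSt]
      have hlift (x : MvPolynomial σ k) : π.liftOfSurjective hπ ⟨ev.toRingHom, hle⟩ (π x) = ev x :=
        π.liftOfSurjective_comp_apply hπ ⟨ev.toRingHom, hle⟩ x
      refine ⟨{ π.liftOfSurjective hπ ⟨ev.toRingHom, hle⟩ with
        commutes' := fun x ↦ (hlift _).trans (DFunLike.congr_fun hψ x) }, fun b hb ↦
        (hlift _).trans ?_⟩
      rw [hev 0 (Nat.zero_le r) b hb, hS0 b hb, zero_sub]
  obtain ⟨_, _⟩ := hfree
  have : IsNoetherianRing B := isNoetherianRing_of_surjective _ _ π hπ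
  exact ((IsCohenMacaulayRing.of_field k).mvPolynomial τ).of_flat_of_isIntegral

theorem ent_add_one {m n : ℕ} (hm : 0 < m) (hn : 0 < n) {i j : ℕ} (hi : i < m) (hj : j < n) :
    ent m n hm hn (i + 1) (j + 1) = (⟨i, hi⟩, ⟨j, hj⟩) := by
  simp [ent, Nat.mod_eq_of_lt hi, Nat.mod_eq_of_lt hj]

/-- **Lemma 3.6.**  Let `I ⊆ k[x_{ij} : 1 ≤ i ≤ m, 1 ≤ j ≤ n]` be the ideal generated by the
monomials `x_{1a₁}x_{2a₂}⋯x_{ma_m}` with `1 ≤ a₁ < ⋯ < a_l ≤ a_{l+1} < ⋯ < a_m ≤ n`.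
Then the Stanley–Reisner ring `R/I` is Cohen–Macaulay. -/
theorem stanleyReisner_isCohenMacaulay (k : Type*) [Field k] (m n l : ℕ)
    (hm : 2 ≤ m) (hmn : m ≤ n) (hl1 : 1 ≤ l) (hlm : l ≤ m - 1) :
    IsCohenMacaulayRing (MvPolynomial (Fin m × Fin n) k ⧸
      Ideal.span {g : MvPolynomial (Fin m × Fin n) k | ∃ a : ℕ → ℕ,
        1 ≤ a 1 ∧ a m ≤ n ∧ a l ≤ a (l + 1) ∧ (∀ i, 1 ≤ i → i < m → i ≠ l → a i < a (i + 1)) ∧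
        g = ∏ i ∈ Finset.Icc 1 m, X (ent m n (by omega) (by omega) i (a i))}) := by
  let d (i : ℕ) : ℕ := if i < l then i else i - 1
  have hd (i : ℕ) (hi : i < m) : d i ≤ m - 2 := by simp only [d]; split_ifs <;> omega
  let V (i b : ℕ) : Fin m × Fin n := ent m n (by omega) (by omega) (i + 1) (b + d i + 1)
  refine isCohenMacaulayRing_of_ker_eq_span_monotone V (m - 1) (n - m + 2) ?_
    (Ideal.Quotient.mk _) Ideal.Quotient.mk_surjective (Ideal.mk_ker.trans ?_)
  · intro i hi b hb i' hi' b' hb' h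
    have h1 := hd i (by omega)
    have h2 := hd i' (by omega)
    simp only [V] at h
    rw [ent_add_one _ _ (by omega) (by omega), ent_add_one _ _ (by omega) (by omega)] at h
    simp only [Prod.mk.injEq, Fin.mk.injEq] at h
    obtain ⟨rfl, h⟩ := h
    exact ⟨rfl, by omega⟩
  have hprod (a : ℕ → ℕ) : ∏ i ∈ Finset.Icc 1 m,
      (X (ent m n (by omega) (by omega) i (a i)) : MvPolynomial (Fin m × Fin n) k) =
      ∏ i ∈ Finset.range m, X (ent m n (by omega) (by omega) (i + 1) (a (i + 1))) := by
    rw [Finset.range_eq_Ico, Finset.prod_Ico_add' (fun i ↦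
      (X (ent m n (by omega) (by omega) i (a i)) : MvPolynomial (Fin m × Fin n) k)) 0 m 1]
    rfl
  congr 1
  ext g
  rw [Set.mem_ofPred_eq, Set.mem_ofPred_eq, show m - 1 + 1 = m by omega]
  constructor
  · rintro ⟨a, ha1, ham, hal, hlt, rfl⟩
    have hmono : ∀ i, i + 1 < m → a (i + 1) - d i - 1 ≤ a (i + 1 + 1) - d (i + 1) - 1 ∧
        d (i + 1) + a (i + 1) ≤ d i + a (i + 1 + 1) := by
      intro i hi
      by_cases h : i + 1 = l
      · subst h
        simp [d] at hal ⊢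
        omega
      · have := hlt (i + 1) (by omega) hi h
        simp only [d]
        split_ifs <;> omega
    have hlow : ∀ i < m, d i + 1 ≤ a (i + 1) := by
      intro i
      induction i with
      | zero => intro _; simpa [d] using ha1
      | succ i ih =>
        intro hi
        have := ih (by omega)
        have := hmono i hi
        omega
    have hb : Monotone fun i ↦ a (min i (m - 1) + 1) - d (min i (m - 1)) - 1 := by
      refine monotone_nat_of_le_succ fun i ↦ ?_
      by_cases hi : i + 1 < m
      · rw [min_eq_left (by omega : i ≤ m - 1), min_eq_left (by omega : i + 1 ≤ m - 1)]
        exact (hmono i hi).1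
      · rw [min_eq_right (by omega : m - 1 ≤ i), min_eq_right (by omega : m - 1 ≤ i + 1)]
    refine ⟨_, hb, fun j hj ↦ (hb (by omega : j ≤ m - 1)).trans_lt ?_, ?_⟩
    · have : d (m - 1) = m - 2 := by simp only [d]; split_ifs <;> omega
      simp only [min_self, this, show m - 1 + 1 = m by omega]
      omega
    · rw [hprod]
      refine Finset.prod_congr rfl fun i hi ↦ ?_
      rw [Finset.mem_range] at hi
      have := hlow i hi
      simp only [V, min_eq_left (by omega : i ≤ m - 1)]
      congr 2
      omega
  · rintro ⟨b, hb, hbN, rfl⟩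
    refine ⟨fun i ↦ b (i - 1) + d (i - 1) + 1, Nat.le_add_left 1 _, ?_, ?_,
      fun i hi him hil ↦ ?_, ?_⟩
    · have h1 := hd (m - 1) (by omega)
      have h2 := hbN (m - 1) (by omega)
      simp only
      omega
    · have := hb (Nat.sub_le l 1)
      simp only [d, Nat.add_sub_cancel]
      split_ifs <;> omega
    · have := hb (Nat.sub_le i 1)
      simp only [d, Nat.add_sub_cancel]
      split_ifs <;> omega
    · rw [hprod]
      rfl
end

section
/- Let k be a field, m ≥ 3, and work in R = k[x_{ij} : 1 ≤ i, j ≤ m]. For 2 ≤ l ≤ m − 1 define the ideal J_l = ({x_{i,i−1}x_{jj} : l ≤ i ≤ m, i ≤ j ≤ m}) + (x_{11}, x_{21}, x_{32}, x_{43}, …, x_{l−1,l−2}) (for l = 2 the second summand is just (x_{11})). Then the principal ideal (x_{l,l−1}) satisfies (x_{l,l−1}) ∩ J_l = x_{l,l−1} · (x_{ll}, x_{l+1,l+1}, …, x_{mm}, x_{11}, x_{21}, x_{32}, …, x_{l−1,l−2}); consequently J_l + (x_{l,l−1}) modulo J_l is isomorphic, as an R-module, to (x_{l,l−1}) / x_{l,l−1}·(x_{ll},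 …, x_{mm}, x_{11}, x_{21}, x_{32}, …, x_{l−1,l−2}). -/
open MvPolynomial Finset

/-- Let `L` be the ideal generated by the variables in `S`. If `t ∉ S`, then `L : X t = L`. -/
theorem MvPolynomial.mem_span_X_image_of_X_mul_mem {σ k : Type*} [CommSemiring k] {S : Set σ}
    {t : σ} (ht : t ∉ S) {q : MvPolynomial σ k}
    (h : X t * q ∈ Ideal.span ((X : σ → MvPolynomial σ k) '' S)) :
    q ∈ Ideal.span ((X : σ → MvPolynomial σ k) '' S) := by
  classical
  rw [mem_ideal_span_X_image] at h ⊢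
  intro d hd
  obtain ⟨i, hi, hne⟩ := h (Finsupp.single t 1 + d) (by
    rw [mem_support_iff] at hd ⊢
    rwa [coeff_X_mul])
  refine ⟨i, hi, ?_⟩
  have hit : t ≠ i := fun e => ht (e ▸ hi)
  simpa [Finsupp.single_apply, hit] using hne

/-- If `X t * L ⊆ J ⊆ L`, where `L` is generated by the variables in `S` and `t ∉ S`, then
`(X t) ∩ J = X t * L`. -/
theorem MvPolynomial.span_X_inf_eq_mul {σ k : Type*} [CommSemiring k] {S : Set σ}
    {t : σ} (ht : t ∉ S) {J L : Ideal (MvPolynomial σ k)}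
    (hL : L = Ideal.span ((X : σ → MvPolynomial σ k) '' S)) (hJL : J ≤ L)
    (hLJ : Ideal.span {X t} * L ≤ J) :
    Ideal.span {X t} ⊓ J = Ideal.span {X t} * L := by
  refine le_antisymm ?_ (le_inf Ideal.mul_le_left hLJ)
  rintro f ⟨hf, hfJ⟩
  obtain ⟨q, rfl⟩ := Ideal.mem_span_singleton.mp hf
  refine Ideal.mul_mem_mul (Ideal.mem_span_singleton_self _) ?_
  have h := hJL hfJ
  subst hL
  exact mem_span_X_image_of_X_mul_mem ht h

/-- The second isomorphism theorem, with the intersection replaced by an equal submodule. -/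
theorem Submodule.nonempty_supQuotient_equiv {R M : Type*} [Ring R] [AddCommGroup M] [Module R M]
    {p p' N : Submodule R M} (h : p ⊓ p' = N) :
    Nonempty ((↥(p' ⊔ p) ⧸ Submodule.comap (p' ⊔ p).subtype p') ≃ₗ[R]
      (↥p ⧸ Submodule.comap p.subtype N)) := by
  subst h
  rw [sup_comm]
  exact ⟨(LinearMap.quotientInfEquivSupQuotient p p').symm⟩

/-- In `R = k[x_{ij} : 1 ≤ i, j ≤ m]`, with
`J_l = ({x_{i,i−1}x_{jj} : l ≤ i ≤ m, i ≤ j ≤ m}) + (x_{11}, x_{21}, x_{32}, …, x_{l−1,l−2})`,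
we have `(x_{l,l−1}) ∩ J_l = x_{l,l−1}·(x_{ll}, …, x_{mm}, x_{11}, x_{21}, x_{32}, …, x_{l−1,l−2})`;
consequently `(J_l + (x_{l,l−1}))/J_l ≅ (x_{l,l−1})/x_{l,l−1}·(x_{ll}, …, x_{mm}, x_{11}, x_{21},
x_{32}, …, x_{l−1,l−2})` as `R`-modules. -/
theorem filtration_step (k : Type*) [Field k] (m l : ℕ) (hm : 3 ≤ m)
    (hl2 : 2 ≤ l) (hlm : l ≤ m - 1) :
    (Ideal.span {(X (ent m m (by omega) (by omega) l (l - 1)) : MvPolynomial (Fin m × Fin m) k)} ⊓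
      Ideal.span ({g : MvPolynomial (Fin m × Fin m) k | ∃ i j, l ≤ i ∧ i ≤ m ∧ i ≤ j ∧ j ≤ m ∧
          g = X (ent m m (by omega) (by omega) i (i - 1)) * X (ent m m (by omega) (by omega) j j)} ∪
        {X (ent m m (by omega) (by omega) 1 1)} ∪
        {g : MvPolynomial (Fin m × Fin m) k | ∃ i, 2 ≤ i ∧ i ≤ l - 1 ∧
          g = X (ent m m (by omega) (by omega) i (i - 1))}) =
      Ideal.span {(X (ent m m (by omega) (by omega) l (l - 1)) : MvPolynomial (Fin m × Fin m) k)} *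
      Ideal.span ({g : MvPolynomial (Fin m × Fin m) k | ∃ j, l ≤ j ∧ j ≤ m ∧
          g = X (ent m m (by omega) (by omega) j j)} ∪
        {X (ent m m (by omega) (by omega) 1 1)} ∪
        {g : MvPolynomial (Fin m × Fin m) k | ∃ i, 2 ≤ i ∧ i ≤ l - 1 ∧
          g = X (ent m m (by omega) (by omega) i (i - 1))})) ∧
    Nonempty (
      let R := MvPolynomial (Fin m × Fin m) k
      let J : Ideal R := Ideal.span ({g : R | ∃ i j, l ≤ i ∧ i ≤ m ∧ i ≤ j ∧ j ≤ m ∧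
          g = X (ent m m (by omega) (by omega) i (i - 1)) * X (ent m m (by omega) (by omega) j j)} ∪
        {X (ent m m (by omega) (by omega) 1 1)} ∪
        {g : R | ∃ i, 2 ≤ i ∧ i ≤ l - 1 ∧ g = X (ent m m (by omega) (by omega) i (i - 1))})
      let P : Ideal R := Ideal.span {(X (ent m m (by omega) (by omega) l (l - 1)) : R)}
      let L : Ideal R := Ideal.span ({g : R | ∃ j, l ≤ j ∧ j ≤ m ∧
          g = X (ent m m (by omega) (by omega) j j)} ∪
        {X (ent m m (by omega) (by omega) 1 1)} ∪
        {g : R | ∃ i, 2 ≤ i ∧ i ≤ l - 1 ∧ g = X (ent m m (by omega) (by omega) i (i - 1))})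
      ((↥(J ⊔ P) ⧸ Submodule.comap (J ⊔ P).subtype J) ≃ₗ[R]
        (↥P ⧸ Submodule.comap P.subtype (P * L)))) := by
  refine (fun h => ⟨h, Submodule.nonempty_supQuotient_equiv h⟩) ?_
  have hm0 : 0 < m := by omega
  refine MvPolynomial.span_X_inf_eq_mul
    (S := {s | ∃ j, l ≤ j ∧ j ≤ m ∧ s = ent m m hm0 hm0 j j} ∪ {ent m m hm0 hm0 1 1} ∪
      {s | ∃ i, 2 ≤ i ∧ i ≤ l - 1 ∧ s = ent m m hm0 hm0 i (i - 1)}) ?_ ?_ ?_ ?_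
  · rintro ((⟨j, hlj, hjm, h⟩ | h) | ⟨i, hi, hil, h⟩) <;>
      simp only [ent, Set.mem_singleton_iff, Prod.mk.injEq, Fin.mk.injEq] at h <;>
      obtain ⟨h₁, h₂⟩ := h <;>
      rw [Nat.mod_eq_of_lt (by omega), Nat.mod_eq_of_lt (by omega)] at h₁ h₂ <;> omega
  · congr 1
    ext g
    simp only [Set.image_union, Set.image_singleton, Set.mem_union, Set.mem_image,
      Set.mem_ofPred_eq, Set.mem_singleton_iff]
    refine or_congr (or_congr ⟨?_, ?_⟩ Iff.rfl) ⟨?_, ?_⟩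
    · rintro ⟨j, h₁, h₂, rfl⟩
      exact ⟨_, ⟨j, h₁, h₂, rfl⟩, rfl⟩
    · rintro ⟨_, ⟨j, h₁, h₂, rfl⟩, rfl⟩
      exact ⟨j, h₁, h₂, rfl⟩
    · rintro ⟨i, h₁, h₂, rfl⟩
      exact ⟨_, ⟨i, h₁, h₂, rfl⟩, rfl⟩
    · rintro ⟨_, ⟨i, h₁, h₂, rfl⟩, rfl⟩
      exact ⟨i, h₁, h₂, rfl⟩
  · rw [Ideal.span_le]
    rintro g ((⟨i, j, hli, him, hij, hjm, rfl⟩ | hg) | hg)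
    · exact Ideal.mul_mem_left _ _
        (Ideal.subset_span (Or.inl (Or.inl ⟨j, hli.trans hij, hjm, rfl⟩)))
    · exact Ideal.subset_span (Or.inl (Or.inr hg))
    · exact Ideal.subset_span (Or.inr hg)
  · rw [Ideal.span_mul_span', Ideal.span_le]
    rintro _ ⟨_, rfl, g, (⟨j, hlj, hjm, rfl⟩ | hg) | hg, rfl⟩
    · exact Ideal.subset_span (Or.inl (Or.inl ⟨l, j, le_rfl, by omega, hlj, hjm, rfl⟩))
    · exact Ideal.mul_mem_left _ _ (Ideal.subset_span (Or.inl (Or.inr hg)))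
    · exact Ideal.mul_mem_left _ _ (Ideal.subset_span (Or.inr hg))
end
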